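/- arXiv:1412.1644 — 4 statements merged into one kernel-verified Lean document; each statement's English description precedes it below -/
import Mathlib

section
/- Let 0 < a < b be real numbers, let n be a positive even integer, and let E = [−b,−a] ∪ [a,b]. If p is a real polynomial of degree at most n such that p(x) > sup_{t∈E} |p(t)| for every x ∈ (−a,a), then sup_{x∈E} |p′(x)| ≤ (n²·b/(b²−a²)) · sup_{x∈E} |p(x)|. -/
open Polynomial Set

/-- `P` is a nonzero constant times the nodal polynomial of `Z`. -/
def IsNodal (P : ℝ[X]) (Z : Finset ℝ) : Prop :=
  ∃ c : ℝ, c ≠ 0 ∧ P = C c * Lagrange.nodal Z id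

lemma isNodal_of_roots {P : ℝ[X]} {Z : Finset ℝ} (hP : P ≠ 0) (hd : P.natDegree ≤ Z.card)
    (hr : ∀ z ∈ Z, P.eval z = 0) : IsNodal P Z := by
  have hle : Z.val ≤ P.roots := by
    rw [Multiset.le_iff_subset Z.nodup]
    intro z hz
    rw [mem_roots hP]
    exact hr z hz
  have hdvd : Lagrange.nodal Z id ∣ P := by
    have := (Multiset.prod_X_sub_C_dvd_iff_le_roots hP Z.val).2 hle
    exact this
  obtain ⟨q, hq⟩ := hdvd
  have hq0 : q ≠ 0 := by rintro rfl; simp at hq; exact hP hq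
  have hn : (Lagrange.nodal Z (id : ℝ → ℝ)) ≠ 0 := Lagrange.nodal_ne_zero
  have hdq : q.natDegree = 0 := by
    rw [hq, natDegree_mul hn hq0, Lagrange.natDegree_nodal] at hd
    omega
  rw [natDegree_eq_zero] at hdq
  obtain ⟨c, rfl⟩ := hdq
  refine ⟨c, ?_, by rw [hq, mul_comm]⟩
  rintro rfl; simp at hq0

lemma IsNodal.eval_ne {P : ℝ[X]} {Z : Finset ℝ} (h : IsNodal P Z) {x : ℝ} (hx : x ∉ Z) :
    P.eval x ≠ 0 := by
  obtain ⟨c, hc, rfl⟩ := h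
  rw [eval_mul, eval_C]
  refine mul_ne_zero hc (Lagrange.eval_nodal_not_at_node ?_)
  rintro i hi rfl
  exact hx hi

lemma IsNodal.lagrange {P : ℝ[X]} {Z : Finset ℝ} (h : IsNodal P Z) {f : ℝ[X]}
    (hf : f.degree < Z.card) {x : ℝ} (hx : x ∉ Z) :
    f.eval x / P.eval x =
      ∑ z ∈ Z, f.eval z / (derivative P).eval z * (x - z)⁻¹ := by
  have hne := h.eval_ne hx
  obtain ⟨c, hc, rfl⟩ := h
  have h1 := Lagrange.eq_interpolate (s := Z) (v := id) (injOn_id _) hf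
  have h2 := congrArg (eval x) h1
  rw [Lagrange.eval_interpolate_not_at_node _ (by rintro i hi rfl; exact hx hi)] at h2
  rw [div_eq_iff hne, h2, eval_mul, eval_C, Finset.mul_sum, Finset.sum_mul]
  refine Finset.sum_congr rfl fun z hz => ?_
  rw [Lagrange.nodalWeight_eq_eval_derivative_nodal hz, derivative_C_mul, eval_mul, eval_C]
  simp only [id]
  field_simp

lemma IsNodal.simple {P : ℝ[X]} {Z : Finset ℝ} (h : IsNodal P Z) {x : ℝ} (hx : x ∈ Z) :
    (derivative P).eval x ≠ 0 := by
  obtain ⟨c, hc, rfl⟩ := h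
  rw [derivative_C_mul, eval_mul, eval_C]
  refine mul_ne_zero hc ?_
  have := Lagrange.nodalWeight_ne_zero (s := Z) (v := (id : ℝ → ℝ)) (injOn_id _) hx
  rw [Lagrange.nodalWeight_eq_eval_derivative_nodal hx] at this
  simpa using this

lemma IsNodal.ne_zero {P : ℝ[X]} {Z : Finset ℝ} (h : IsNodal P Z) : P ≠ 0 := by
  obtain ⟨c, hc, rfl⟩ := h
  exact mul_ne_zero (by simpa using hc) Lagrange.nodal_ne_zero

lemma IsNodal.natDegree {P : ℝ[X]} {Z : Finset ℝ} (h : IsNodal P Z) : P.natDegree = Z.card := by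
  obtain ⟨c, hc, rfl⟩ := h
  rw [natDegree_C_mul hc, Lagrange.natDegree_nodal]

lemma IsNodal.eval_eq {P : ℝ[X]} {Z : Finset ℝ} (h : IsNodal P Z) {x : ℝ} (hx : x ∈ Z) :
    P.eval x = 0 := by
  obtain ⟨c, hc, rfl⟩ := h
  rw [eval_mul]
  simp only [mul_eq_zero]
  exact Or.inr (Lagrange.eval_nodal_at_node (v := (id : ℝ → ℝ)) hx)

/-- Differentiated interpolation formula, degree `< card`. -/
lemma IsNodal.lagrange_deriv_aux {P : ℝ[X]} {Z : Finset ℝ} (h : IsNodal P Z) {f : ℝ[X]}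
    (hf : f.degree < Z.card) {x : ℝ} (hx : x ∉ Z) :
    ((derivative f).eval x * P.eval x - f.eval x * (derivative P).eval x) / P.eval x ^ 2 =
      ∑ z ∈ Z, f.eval z / (derivative P).eval z * (-1 / (x - z) ^ 2) := by
  have hne := h.eval_ne hx
  have h1 : HasDerivAt (fun x => f.eval x / P.eval x)
      (((derivative f).eval x * P.eval x - f.eval x * (derivative P).eval x) / P.eval x ^ 2) x :=
    (f.hasDerivAt x).div (P.hasDerivAt x) hne
  have h2 : HasDerivAt (fun x => ∑ z ∈ Z, f.eval z / (derivative P).eval z * (x - z)⁻¹)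
      (∑ z ∈ Z, f.eval z / (derivative P).eval z * (-1 / (x - z) ^ 2)) x := by
    refine HasDerivAt.fun_sum fun z hz => ?_
    have hxz : x - z ≠ 0 := sub_ne_zero.2 (by rintro rfl; exact hx hz)
    exact (((hasDerivAt_id x).sub_const z).inv hxz).const_mul _
  refine h1.unique (h2.congr_of_eventuallyEq ?_)
  have : ∀ᶠ y in nhds x, y ∉ Z := by
    have : IsOpen ((Z : Set ℝ)ᶜ) := Z.finite_toSet.isClosed.isOpen_compl
    exact this.mem_nhds (by simpa using hx)
  filter_upwards [this] with y hy
  exact h.lagrange hf hy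

/-- Differentiated interpolation formula, degree `≤ card`. -/
lemma IsNodal.lagrange_deriv {P : ℝ[X]} {Z : Finset ℝ} (h : IsNodal P Z) {f : ℝ[X]}
    (hf : f.natDegree ≤ Z.card) {x : ℝ} (hx : x ∉ Z) :
    ((derivative f).eval x * P.eval x - f.eval x * (derivative P).eval x) / P.eval x ^ 2 =
      ∑ z ∈ Z, f.eval z / (derivative P).eval z * (-1 / (x - z) ^ 2) := by
  have hPd : P.degree = Z.card := by rw [degree_eq_natDegree h.ne_zero, h.natDegree]
  have hmod : (f % P).degree < Z.card := hPd ▸ degree_mod_lt f h.ne_zero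
  have hdiv : (f / P).natDegree = 0 := by
    by_cases hlt : f.degree < P.degree
    · rw [(Polynomial.div_eq_zero_iff h.ne_zero).2 hlt]; simp
    · have hPf : P.degree ≤ f.degree := not_lt.1 hlt
      have h3 := degree_add_div h.ne_zero hPf
      have hf0 : f ≠ 0 := by rintro rfl; simp at hPf; exact h.ne_zero hPf
      have hq0 : f / P ≠ 0 := by rw [Ne, Polynomial.div_eq_zero_iff h.ne_zero]; exact hlt
      rw [degree_eq_natDegree h.ne_zero, degree_eq_natDegree hf0, degree_eq_natDegree hq0] at h3
      have h4 : P.natDegree + (f / P).natDegree = f.natDegree := by exact_mod_cast h3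
      rw [h.natDegree] at h4
      omega
  rw [natDegree_eq_zero] at hdiv
  obtain ⟨c, hc⟩ := hdiv
  have hf2 : f = P * C c + f % P := by rw [hc]; exact (EuclideanDomain.div_add_mod f P).symm
  set g := f % P with hg
  have := h.lagrange_deriv_aux hmod hx
  rw [hf2]
  have hz : ∀ z ∈ Z, (P * C c + g).eval z = g.eval z := by
    intro z hz; simp [h.eval_eq hz]
  rw [Finset.sum_congr rfl (fun z hz' => by rw [hz z hz']), ← this]
  congr 1
  simp
  ring

lemma one_sub_mul_pos {u s : ℝ} (hu : |u| ≤ 1) (hs : |s| < 1) : 0 < 1 - u * s := by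
  have h1 : u * s ≤ |u| * |s| := by rw [← abs_mul]; exact le_abs_self _
  have h2 : |u| * |s| ≤ 1 * |s| := by gcongr
  linarith

lemma cheb_ode (m : ℕ) (x : ℝ) :
    (1 - x ^ 2) * (derivative (derivative (Chebyshev.T ℝ m))).eval x =
      x * (derivative (Chebyshev.T ℝ m)).eval x - (m : ℝ) ^ 2 * (Chebyshev.T ℝ m).eval x := by
  have := Chebyshev.one_sub_X_sq_mul_iterate_derivative_T_eval (R := ℝ) m 0 x
  simpa using this

lemma cheb_pyth (m : ℕ) {x : ℝ} (hx : |x| ≤ 1) :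
    (1 - x ^ 2) * (derivative (Chebyshev.T ℝ m)).eval x ^ 2 +
      (m : ℝ) ^ 2 * (Chebyshev.T ℝ m).eval x ^ 2 = (m : ℝ) ^ 2 := by
  have h := abs_le.1 hx
  obtain ⟨θ, rfl⟩ : ∃ θ, x = Real.cos θ := ⟨Real.arccos x, (Real.cos_arccos h.1 h.2).symm⟩
  have h1 : (derivative (Chebyshev.T ℝ m)).eval (Real.cos θ) * Real.sin θ
      = m * Real.sin (m * θ) := by
    have := Chebyshev.U_real_cos θ ((m : ℤ) - 1)
    rw [Chebyshev.T_derivative_eq_U]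
    simp only [eval_mul, Int.cast_natCast, eval_natCast]
    rw [mul_assoc, this]
    push_cast
    ring_nf
  have h2 := Chebyshev.T_real_cos θ (m : ℤ)
  rw [h2]
  have h3 : (1 - Real.cos θ ^ 2) = Real.sin θ ^ 2 := by
    have := Real.sin_sq_add_cos_sq θ; linarith
  rw [h3, mul_comm, ← mul_pow, h1]
  have := Real.sin_sq_add_cos_sq (m * θ)
  push_cast
  linear_combination (m : ℝ) ^ 2 * this

lemma exists_cheb (m : ℕ) (hm : 0 < m) : ∃ (T : ℝ[X]) (S Q : Finset ℝ),
    T.natDegree = m ∧ IsNodal T S ∧ S.card = m ∧ Q.card = m + 1 ∧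
    (∀ s ∈ S, |s| < 1) ∧ (∀ q ∈ Q, |q| ≤ 1) ∧
    (∀ x, (1 - x ^ 2) * (derivative (derivative T)).eval x =
      x * (derivative T).eval x - (m : ℝ) ^ 2 * T.eval x) ∧
    (∀ x, |x| ≤ 1 → (1 - x ^ 2) * (derivative T).eval x ^ 2 +
      (m : ℝ) ^ 2 * T.eval x ^ 2 = (m : ℝ) ^ 2) ∧
    (∀ q ∈ Q, T.eval q ^ 2 = 1) := by
  have hm0 : (m : ℝ) ≠ 0 := by positivity
  set T := Chebyshev.T ℝ m with hT
  set Q := (Finset.range (m + 1)).image (Chebyshev.node m) with hQ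
  have hdeg : T.natDegree = m := by simp [hT, Chebyshev.natDegree_T]
  have hT0 : T ≠ 0 := Chebyshev.T_ne_zero ℝ m
  have hroots := Chebyshev.roots_T_real m
  set S := (Finset.range m).image (fun (k : ℕ) => Real.cos ((2 * k + 1) * Real.pi / (2 * m)))
    with hS
  have hcS : S.card = m := by
    rw [hS, Finset.card_image_of_injOn, Finset.card_range]
    exact (Finset.range m).nodup_map_iff_injOn.mp (Chebyshev.roots_T_real_nodup m)
  have hrS : ∀ s ∈ S, T.eval s = 0 := by
    intro s hs
    have : s ∈ T.roots := by rw [hT, hroots]; exact hs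
    exact (mem_roots hT0).1 this
  refine ⟨T, S, Q, hdeg, isNodal_of_roots hT0 (by omega) hrS, hcS, ?_, ?_, ?_, cheb_ode m,
    fun x hx => cheb_pyth m hx, ?_⟩
  · rw [hQ, Finset.card_image_of_injOn, Finset.card_range]
    have := (Chebyshev.strictAntiOn_node m).injOn
    intro i hi j hj hij
    refine this ?_ ?_ hij <;> simp at * <;> omega
  · intro s hs
    have h0 := hrS s hs
    obtain ⟨k, hk, rfl⟩ := Finset.mem_image.1 hs
    rw [← not_le]
    intro hle
    have := Chebyshev.one_le_abs_eval_T_real (m : ℤ) hle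
    rw [← hT, h0] at this
    norm_num at this
  · intro q hq
    obtain ⟨k, hk, rfl⟩ := Finset.mem_image.1 hq
    exact abs_le.2 Chebyshev.node_mem_Icc
  · intro q hq
    obtain ⟨k, hk, rfl⟩ := Finset.mem_image.1 hq
    have := Chebyshev.eval_T_real_node (n := m) (i := k) (by simp at hk ⊢; omega)
    rw [hT, this, ← pow_mul, mul_comm, pow_mul]; simp

/-- log-derivative sums -/
lemma IsNodal.logderiv {P : ℝ[X]} {Z : Finset ℝ} (h : IsNodal P Z) {x : ℝ} (hx : x ∉ Z) :
    ∑ z ∈ Z, (x - z)⁻¹ = (derivative P).eval x / P.eval x := by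
  have hd : (derivative P).degree < Z.card := by
    have := degree_derivative_lt h.ne_zero
    rwa [degree_eq_natDegree h.ne_zero, h.natDegree] at this
  rw [h.lagrange hd hx]
  refine Finset.sum_congr rfl fun z hz => ?_
  rw [div_self (h.simple hz), one_mul]

lemma IsNodal.logderiv2 {P : ℝ[X]} {Z : Finset ℝ} (h : IsNodal P Z) {x : ℝ} (hx : x ∉ Z) :
    P.eval x ^ 2 * ∑ z ∈ Z, ((x - z) ^ 2)⁻¹ =
      (derivative P).eval x ^ 2 - P.eval x * (derivative (derivative P)).eval x := by
  have hd : (derivative P).degree < Z.card := by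
    have := degree_derivative_lt h.ne_zero
    rwa [degree_eq_natDegree h.ne_zero, h.natDegree] at this
  have h1 := h.lagrange_deriv_aux hd hx
  have h2 : ∑ z ∈ Z, (derivative P).eval z / (derivative P).eval z * (-1 / (x - z) ^ 2)
      = - ∑ z ∈ Z, ((x - z) ^ 2)⁻¹ := by
    rw [← Finset.sum_neg_distrib]
    refine Finset.sum_congr rfl fun z hz => ?_
    rw [div_self (h.simple hz)]; ring
  rw [h2] at h1
  have hne := h.eval_ne hx
  rw [div_eq_iff (pow_ne_zero 2 hne)] at h1
  linarith

/-- `T` with simple roots `S` in `(-1,1)`, solving the Chebyshev equation. -/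
lemma sum_inv_one_sub {T : ℝ[X]} {S : Finset ℝ} {m : ℕ} (hm : 0 < m) (hTS : IsNodal T S)
    (hS : ∀ s ∈ S, |s| < 1)
    (ode : ∀ x, (1 - x ^ 2) * (derivative (derivative T)).eval x =
      x * (derivative T).eval x - (m : ℝ) ^ 2 * T.eval x) :
    ∑ s ∈ S, (1 - s)⁻¹ = (m : ℝ) ^ 2 ∧ ∑ s ∈ S, (1 + s)⁻¹ = (m : ℝ) ^ 2 := by
  have h1 : (1 : ℝ) ∉ S := fun h => by have := hS 1 h; norm_num at this
  have h2 : (-1 : ℝ) ∉ S := fun h => by have := hS (-1) h; norm_num at this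
  have e1 := hTS.eval_ne h1
  have e2 := hTS.eval_ne h2
  constructor
  · rw [hTS.logderiv h1, div_eq_iff e1]
    have := ode 1; norm_num at this; linarith
  · have h3 : ∑ s ∈ S, (1 + s)⁻¹ = - ∑ s ∈ S, (-1 - s)⁻¹ := by
      rw [← Finset.sum_neg_distrib]
      refine Finset.sum_congr rfl fun z hz => ?_
      rw [← inv_neg]; ring_nf
    rw [h3, hTS.logderiv h2, neg_eq_iff_eq_neg, div_eq_iff e2]
    have := ode (-1); norm_num at this; linarith

lemma sum_inv_one_sub_mul {T : ℝ[X]} {S : Finset ℝ} {m : ℕ} (hm : 0 < m) (hTS : IsNodal T S)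
    (hS : ∀ s ∈ S, |s| < 1)
    (ode : ∀ x, (1 - x ^ 2) * (derivative (derivative T)).eval x =
      x * (derivative T).eval x - (m : ℝ) ^ 2 * T.eval x) {u : ℝ} (hu : |u| ≤ 1) :
    ∑ s ∈ S, (1 - u * s)⁻¹ ≤ (m : ℝ) ^ 2 := by
  obtain ⟨h1, h2⟩ := sum_inv_one_sub hm hTS hS ode
  have hu' := abs_le.1 hu
  calc ∑ s ∈ S, (1 - u * s)⁻¹
      ≤ ∑ s ∈ S, ((1 + u) / 2 * (1 - s)⁻¹ + (1 - u) / 2 * (1 + s)⁻¹) := by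
        refine Finset.sum_le_sum fun s hs => ?_
        have hs' := abs_lt.1 (hS s hs)
        have p1 : 0 < 1 - s := by linarith
        have p2 : 0 < 1 + s := by linarith
        have p3 : 0 < 1 - u * s := one_sub_mul_pos hu (hS s hs)
        have e : (1 + u) / 2 * (1 - s)⁻¹ + (1 - u) / 2 * (1 + s)⁻¹
            = (1 + u * s) / ((1 - s) * (1 + s)) := by field_simp; ring
        rw [e, inv_eq_one_div, div_le_div_iff₀ p3 (by positivity)]
        have : u ^ 2 ≤ 1 := by nlinarith
        nlinarith [sq_nonneg s]
    _ = (m : ℝ) ^ 2 := by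
        rw [Finset.sum_add_distrib, ← Finset.mul_sum, ← Finset.mul_sum, h1, h2]; ring

/-- The key one-interval estimate. -/
lemma key_sum {T : ℝ[X]} {S : Finset ℝ} {m : ℕ} (hm : 0 < m) (hTS : IsNodal T S)
    (hS : ∀ s ∈ S, |s| < 1)
    (ode : ∀ x, (1 - x ^ 2) * (derivative (derivative T)).eval x =
      x * (derivative T).eval x - (m : ℝ) ^ 2 * T.eval x)
    (pyth : ∀ x, |x| ≤ 1 → (1 - x ^ 2) * (derivative T).eval x ^ 2 +
      (m : ℝ) ^ 2 * T.eval x ^ 2 = (m : ℝ) ^ 2)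
    {u : ℝ} (hu : |u| ≤ 1) (huS : u ∉ S) :
    |T.eval u| * ∑ s ∈ S, |u - s|⁻¹ ≤ (m : ℝ) ^ 2 := by
  have hu' := abs_le.1 hu
  have pos : ∀ s ∈ S, 0 < 1 - u * s := fun s hs => one_sub_mul_pos hu (hS s hs)
  have hB := sum_inv_one_sub_mul hm hTS hS ode hu
  have hA : T.eval u ^ 2 * ∑ s ∈ S, (1 - u * s) / (u - s) ^ 2 = (m : ℝ) ^ 2 := by
    have e : ∑ s ∈ S, (1 - u * s) / (u - s) ^ 2
        = (1 - u ^ 2) * ∑ s ∈ S, ((u - s) ^ 2)⁻¹ + u * ∑ s ∈ S, (u - s)⁻¹ := by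
      rw [Finset.mul_sum, Finset.mul_sum, ← Finset.sum_add_distrib]
      refine Finset.sum_congr rfl fun s hs => ?_
      have : u - s ≠ 0 := sub_ne_zero.2 (by rintro rfl; exact huS hs)
      field_simp; ring
    have l2 := hTS.logderiv2 huS
    have hne := hTS.eval_ne huS
    have l1 : T.eval u * ∑ s ∈ S, (u - s)⁻¹ = (derivative T).eval u := by
      rw [hTS.logderiv huS]; field_simp
    rw [e]
    linear_combination (1 - u ^ 2) * l2 + u * T.eval u * l1 + pyth u hu - T.eval u * ode u
  have cs : (∑ s ∈ S, |u - s|⁻¹) ^ 2 ≤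
      (∑ s ∈ S, (1 - u * s) / (u - s) ^ 2) * ∑ s ∈ S, (1 - u * s)⁻¹ := by
    refine Finset.sum_sq_le_sum_mul_sum_of_sq_le_mul S (fun s hs => ?_) (fun s hs => ?_)
      (fun s hs => ?_)
    · have := pos s hs; positivity
    · have := pos s hs; positivity
    · have := pos s hs
      rw [inv_pow, sq_abs]
      refine le_of_eq ?_
      field_simp
  refine abs_le_of_sq_le_sq' ?_ (by positivity) |>.2
  rw [mul_pow, sq_abs]
  calc T.eval u ^ 2 * (∑ s ∈ S, |u - s|⁻¹) ^ 2
      ≤ T.eval u ^ 2 * ((∑ s ∈ S, (1 - u * s) / (u - s) ^ 2) * ∑ s ∈ S, (1 - u * s)⁻¹) := by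
        gcongr
    _ = (m : ℝ) ^ 2 * ∑ s ∈ S, (1 - u * s)⁻¹ := by rw [← mul_assoc, hA]
    _ ≤ (m : ℝ) ^ 2 * (m : ℝ) ^ 2 := by gcongr
    _ = _ := by ring

lemma key_root {T : ℝ[X]} {S : Finset ℝ} {m : ℕ} (hm : 0 < m) (hTS : IsNodal T S)
    (hS : ∀ s ∈ S, |s| < 1)
    (ode : ∀ x, (1 - x ^ 2) * (derivative (derivative T)).eval x =
      x * (derivative T).eval x - (m : ℝ) ^ 2 * T.eval x)
    (pyth : ∀ x, |x| ≤ 1 → (1 - x ^ 2) * (derivative T).eval x ^ 2 +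
      (m : ℝ) ^ 2 * T.eval x ^ 2 = (m : ℝ) ^ 2)
    {u : ℝ} (huS : u ∈ S) :
    |(derivative T).eval u| ≤ (m : ℝ) ^ 2 := by
  have hu := hS u huS
  have hu' := abs_lt.1 hu
  have pos : ∀ s ∈ S, 0 < 1 - u * s := fun s hs => one_sub_mul_pos hu.le (hS s hs)
  have hB := sum_inv_one_sub_mul hm hTS hS ode hu.le
  have h1 : (1 - u * u)⁻¹ ≤ ∑ s ∈ S, (1 - u * s)⁻¹ :=
    Finset.single_le_sum (f := fun s => (1 - u * s)⁻¹)
      (fun s hs => (inv_pos.2 (pos s hs)).le) huS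
  have h2 := h1.trans hB
  have hp := pyth u hu.le
  rw [hTS.eval_eq huS] at hp
  have p := pos u huS
  rw [inv_le_iff_one_le_mul₀ p] at h2
  refine abs_le_of_sq_le_sq (?_) (by positivity)
  have : (derivative T).eval u ^ 2 * 1 ≤
      (derivative T).eval u ^ 2 * ((m : ℝ) ^ 2 * (1 - u * u)) := by gcongr
  nlinarith [hp, this]

/-- positive preimage of `s` under the quadratic map -/
noncomputable def rr (a b s : ℝ) : ℝ := Real.sqrt ((a ^ 2 + b ^ 2) / 2 + (b ^ 2 - a ^ 2) / 2 * s)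

/-- the quadratic map, mapping both intervals onto `[-1,1]` -/
noncomputable def vv (a b x : ℝ) : ℝ := (2 * x ^ 2 - a ^ 2 - b ^ 2) / (b ^ 2 - a ^ 2)

/-- the quadratic map as a polynomial -/
noncomputable def VV (a b : ℝ) : ℝ[X] :=
  C (2 / (b ^ 2 - a ^ 2)) * X ^ 2 + C (-(a ^ 2 + b ^ 2) / (b ^ 2 - a ^ 2))

/-- preimage of a finite set -/
noncomputable def ZZ (a b : ℝ) (S : Finset ℝ) : Finset ℝ :=
  S.image (rr a b) ∪ S.image (fun s => - rr a b s)

lemma VV_eval (a b x : ℝ) : (VV a b).eval x = vv a b x := by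
  simp [VV, vv]; ring

lemma VV_deriv (a b x : ℝ) : (derivative (VV a b)).eval x = 4 * x / (b ^ 2 - a ^ 2) := by
  simp [VV]; ring

lemma exists_quad (c1 c2 c3 : ℝ) : ∃ N : ℝ[X], N.natDegree ≤ 2 ∧
    (∀ x, N.eval x = c1 * (x ^ 2 - c2) + c3 * x) ∧
    (∀ x, (derivative N).eval x = c1 * (2 * x) + c3) := by
  refine ⟨C c1 * (X ^ 2 - C c2) + C c3 * X, ?_, ?_, ?_⟩
  · compute_degree
  · intro x; simp
  · intro x; simp; norm_num

lemma D_pos {a b : ℝ} (ha : 0 < a) (hab : a < b) : 0 < b ^ 2 - a ^ 2 := by nlinarith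

lemma VV_natDegree {a b : ℝ} (ha : 0 < a) (hab : a < b) : (VV a b).natDegree = 2 := by
  have := D_pos ha hab
  have h : (2 / (b ^ 2 - a ^ 2)) ≠ 0 := by positivity
  unfold VV
  rw [natDegree_add_C, natDegree_C_mul_X_pow 2 _ h]

lemma rr_sq {a b : ℝ} (ha : 0 < a) (hab : a < b) {s : ℝ} (hs : |s| ≤ 1) :
    rr a b s ^ 2 = (a ^ 2 + b ^ 2) / 2 + (b ^ 2 - a ^ 2) / 2 * s := by
  have := D_pos ha hab
  have := abs_le.1 hs
  unfold rr
  rw [Real.sq_sqrt]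
  nlinarith

lemma rr_mem {a b : ℝ} (ha : 0 < a) (hab : a < b) {s : ℝ} (hs : |s| ≤ 1) : a ≤ rr a b s ∧ rr a b s ≤ b := by
  have h1 := D_pos ha hab
  have h2 := abs_le.1 hs
  unfold rr
  constructor
  · apply Real.le_sqrt_of_sq_le; nlinarith
  · rw [Real.sqrt_le_left (by linarith)]; nlinarith

lemma vv_rr {a b : ℝ} (ha : 0 < a) (hab : a < b) {s : ℝ} (hs : |s| ≤ 1) : vv a b (rr a b s) = s := by
  have h1 := D_pos ha hab
  unfold vv
  rw [rr_sq ha hab hs]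
  field_simp; ring

lemma mem_ZZ {a b : ℝ} (ha : 0 < a) (hab : a < b) {S : Finset ℝ} (hS : ∀ s ∈ S, |s| ≤ 1) {x : ℝ} : x ∈ ZZ a b S ↔ vv a b x ∈ S := by
  have h1 := D_pos ha hab
  constructor
  · intro h
    simp only [ZZ, Finset.mem_union, Finset.mem_image] at h
    rcases h with ⟨s, hs, rfl⟩ | ⟨s, hs, rfl⟩
    · rwa [vv_rr ha hab (hS s hs)]
    · have : vv a b (-rr a b s) = vv a b (rr a b s) := by unfold vv; ring
      rwa [this, vv_rr ha hab (hS s hs)]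
  · intro h
    have h2 : rr a b (vv a b x) ^ 2 = x ^ 2 := by
      rw [rr_sq ha hab (hS _ h)]; unfold vv; field_simp; ring
    simp only [ZZ, Finset.mem_union, Finset.mem_image]
    rcases sq_eq_sq_iff_eq_or_eq_neg.1 h2 with h3 | h3
    · exact Or.inl ⟨_, h, h3⟩
    · exact Or.inr ⟨_, h, by linarith⟩

lemma ZZ_bound {a b : ℝ} (ha : 0 < a) (hab : a < b) {S : Finset ℝ} (hS : ∀ s ∈ S, |s| ≤ 1) {x : ℝ} (hx : x ∈ ZZ a b S) :
    a ≤ |x| ∧ |x| ≤ b := by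
  simp only [ZZ, Finset.mem_union, Finset.mem_image] at hx
  rcases hx with ⟨s, hs, rfl⟩ | ⟨s, hs, rfl⟩ <;> have h := rr_mem ha hab (hS s hs)
  · rw [abs_of_pos (by linarith)]; exact h
  · rw [abs_neg, abs_of_pos (by linarith)]; exact h

lemma rr_injOn {a b : ℝ} (ha : 0 < a) (hab : a < b) {S : Finset ℝ} (hS : ∀ s ∈ S, |s| ≤ 1) : InjOn (rr a b) S := by
  intro s hs t ht h
  rw [← vv_rr ha hab (hS s hs), ← vv_rr ha hab (hS t ht), h]

lemma ZZ_disj {a b : ℝ} (ha : 0 < a) (hab : a < b) {S : Finset ℝ} (hS : ∀ s ∈ S, |s| ≤ 1) :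
    Disjoint (S.image (rr a b)) (S.image (fun s => - rr a b s)) := by
  rw [Finset.disjoint_left]
  intro x h1 h2
  obtain ⟨s, hs, rfl⟩ := Finset.mem_image.1 h1
  obtain ⟨t, ht, h⟩ := Finset.mem_image.1 h2
  have := rr_mem ha hab (hS s hs)
  have := rr_mem ha hab (hS t ht)
  linarith

lemma ZZ_sum {a b : ℝ} (ha : 0 < a) (hab : a < b) {S : Finset ℝ} (hS : ∀ s ∈ S, |s| ≤ 1) (f : ℝ → ℝ) :
    ∑ z ∈ ZZ a b S, f z = ∑ s ∈ S, (f (rr a b s) + f (- rr a b s)) := by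
  have hi := rr_injOn ha hab hS
  unfold ZZ
  rw [Finset.sum_union (ZZ_disj ha hab hS), Finset.sum_image hi,
    Finset.sum_image (fun s hs t ht h => hi hs ht (neg_injective h)), Finset.sum_add_distrib]

lemma ZZ_card {a b : ℝ} (ha : 0 < a) (hab : a < b) {S : Finset ℝ} (hS : ∀ s ∈ S, |s| ≤ 1) : (ZZ a b S).card = 2 * S.card := by
  have hi := rr_injOn ha hab hS
  unfold ZZ
  rw [Finset.card_union_of_disjoint (ZZ_disj ha hab hS), Finset.card_image_of_injOn hi,
    Finset.card_image_of_injOn (fun s hs t ht h => hi hs ht (neg_injective h))]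
  ring

lemma vv_zero {a b : ℝ} (ha : 0 < a) (hab : a < b) : vv a b 0 < -1 := by
  have h1 := D_pos ha hab
  unfold vv
  rw [div_lt_iff₀ h1]
  nlinarith

lemma vv_abs {a b : ℝ} (ha : 0 < a) (hab : a < b) {x : ℝ} (h1 : a ≤ |x|) (h2 : |x| ≤ b) : |vv a b x| ≤ 1 := by
  have h := D_pos ha hab
  have e := sq_abs x
  unfold vv
  rw [abs_le, le_div_iff₀ h, div_le_iff₀ h]
  constructor <;> nlinarith

lemma comp_nodal {a b : ℝ} (ha : 0 < a) (hab : a < b) {P : ℝ[X]} {S : Finset ℝ} (hS : ∀ s ∈ S, |s| ≤ 1) (hP : IsNodal P S) :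
    IsNodal (P.comp (VV a b)) (ZZ a b S) := by
  refine isNodal_of_roots ?_ ?_ ?_
  · intro h0
    have h1 := congrArg (eval 0) h0
    rw [eval_comp, VV_eval, eval_zero] at h1
    refine hP.eval_ne (fun h => ?_) h1
    have := (abs_le.1 (hS _ h)).1
    have := vv_zero ha hab
    linarith
  · rw [natDegree_comp, VV_natDegree ha hab, hP.natDegree, ZZ_card ha hab hS, mul_comm]
  · intro z hz
    rw [eval_comp, VV_eval]
    exact hP.eval_eq ((mem_ZZ ha hab hS).1 hz)

set_option maxHeartbeats 2000000 in
/-- Bernstein inequality at the zeros of the extremal polynomial. -/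
lemma bernstein_at_zero {a b : ℝ} (ha : 0 < a) (hab : a < b) {T : ℝ[X]} {S Q : Finset ℝ} {m : ℕ} (hm : 0 < m)
    (hdeg : T.natDegree = m) (hTS : IsNodal T S) (hSc : S.card = m) (hQc : Q.card = m + 1)
    (hS : ∀ s ∈ S, |s| < 1) (hQ : ∀ q ∈ Q, |q| ≤ 1)
    (ode : ∀ x, (1 - x ^ 2) * (derivative (derivative T)).eval x =
      x * (derivative T).eval x - (m : ℝ) ^ 2 * T.eval x)
    (pyth : ∀ x, |x| ≤ 1 → (1 - x ^ 2) * (derivative T).eval x ^ 2 +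
      (m : ℝ) ^ 2 * T.eval x ^ 2 = (m : ℝ) ^ 2)
    (hQT : ∀ q ∈ Q, T.eval q ^ 2 = 1)
    {p : ℝ[X]} (hp : p.natDegree ≤ 2 * m) {M : ℝ}
    (hM : ∀ x, a ≤ |x| → |x| ≤ b → |p.eval x| ≤ M)
    {ξ : ℝ} (hξ : ξ ∈ ZZ a b S) :
    |(derivative p).eval ξ| ≤ M * |(derivative (T.comp (VV a b))).eval ξ| := by
  have hD := D_pos ha hab
  have hmR : (0 : ℝ) < m := by exact_mod_cast hm
  have hS' : ∀ s ∈ S, |s| ≤ 1 := fun s hs => (hS s hs).le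
  set W : ℝ[X] := (X ^ 2 - 1) * derivative T with hW
  have hWe : ∀ x, W.eval x = (x ^ 2 - 1) * (derivative T).eval x := by intro x; simp [hW]
  have hW' : ∀ x, (derivative W).eval x = x * (derivative T).eval x + (m : ℝ) ^ 2 * T.eval x := by
    intro x
    have := ode x
    simp [hW]
    linear_combination -this
  have hW0 : W ≠ 0 := by
    intro h0
    have : S.Nonempty := by rw [← Finset.card_pos]; omega
    obtain ⟨s, hs⟩ := this
    have h1 := pyth s (hS' s hs)
    have h2 := hWe s
    rw [h0, eval_zero] at h2
    rw [hTS.eval_eq hs] at h1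
    have : (m : ℝ) ^ 2 = 0 := by linear_combination -h1 + (derivative T).eval s * h2
    have : (0 : ℝ) < (m : ℝ) ^ 2 := by positivity
    linarith
  have hWQ0 : ∀ q ∈ Q, (1 - q ^ 2) * (derivative T).eval q ^ 2 = 0 := by
    intro q hq
    have := pyth q (hQ q hq)
    rw [hQT q hq] at this
    linarith
  have hWQ : IsNodal W Q := by
    refine isNodal_of_roots hW0 ?_ ?_
    · rw [hQc]
      refine natDegree_mul_le.trans ?_
      have h1 : (X ^ 2 - 1 : ℝ[X]).natDegree ≤ 2 := by
        have : (X ^ 2 - 1 : ℝ[X]) = X ^ 2 - C 1 := by simp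
        rw [this, natDegree_X_pow_sub_C]
      have h2 := natDegree_derivative_le T
      omega
    · intro q hq
      rw [hWe]
      rcases mul_eq_zero.1 (hWQ0 q hq) with h | h
      · rw [show q ^ 2 - 1 = 0 by linarith, zero_mul]
      · rw [pow_eq_zero_iff two_ne_zero] at h; rw [h, mul_zero]
  have hWpos : ∀ q ∈ Q, 0 < T.eval q * (derivative W).eval q := by
    intro q hq
    rw [hW']
    have h1 := hQT q hq
    rcases mul_eq_zero.1 (hWQ0 q hq) with h | h
    · have h2 := ode q
      rw [h, zero_mul] at h2
      have : T.eval q * (q * (derivative T).eval q + (m : ℝ) ^ 2 * T.eval q) = 2 * (m : ℝ) ^ 2 := by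
        linear_combination -T.eval q * h2 + 2 * (m : ℝ) ^ 2 * h1
      rw [this]; positivity
    · rw [pow_eq_zero_iff two_ne_zero] at h
      have : T.eval q * (q * (derivative T).eval q + (m : ℝ) ^ 2 * T.eval q) = (m : ℝ) ^ 2 := by
        rw [h]; linear_combination (m : ℝ) ^ 2 * h1
      rw [this]; positivity
  set t := T.comp (VV a b) with ht
  set Ω := W.comp (VV a b) with hΩ
  have hΩn : IsNodal Ω (ZZ a b Q) := comp_nodal ha hab hQ hWQ
  have hΩe : ∀ x, Ω.eval x = W.eval (vv a b x) := by
    intro x; rw [hΩ, eval_comp, VV_eval]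
  have hΩ' : ∀ x, (derivative Ω).eval x =
      (derivative W).eval (vv a b x) * (4 * x / (b ^ 2 - a ^ 2)) := by
    intro x; rw [hΩ, derivative_comp, eval_mul, eval_comp, VV_eval, VV_deriv, mul_comm]
  have hte : ∀ x, t.eval x = T.eval (vv a b x) := by
    intro x; rw [ht, eval_comp, VV_eval]
  obtain ⟨N, hNd, hNe, hN'⟩ := exists_quad (a * b - ξ ^ 2) (a * b) (ξ * (b - a) ^ 2)
  clear_value t Ω W
  set v := vv a b ξ with hv
  have hvS : v ∈ S := (mem_ZZ ha hab hS').1 hξ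
  have hTv : T.eval v = 0 := hTS.eval_eq hvS
  have hv1 : v ^ 2 < 1 := by
    have := abs_lt.1 (hS v hvS); nlinarith
  have hT'v := hTS.simple hvS
  obtain ⟨hξa, hξb⟩ := ZZ_bound ha hab hS' hξ
  have hξ0 : ξ ≠ 0 := by rintro rfl; simp at hξa; linarith
  have hvD : v * (b ^ 2 - a ^ 2) = 2 * ξ ^ 2 - a ^ 2 - b ^ 2 := by
    rw [hv]; unfold vv; field_simp
  have hNξ : N.eval ξ = (b ^ 2 - a ^ 2) ^ 2 * (1 - v ^ 2) / 4 := by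
    rw [hNe]; linear_combination (1 / 4) * (v * (b ^ 2 - a ^ 2) + (2 * ξ ^ 2 - a ^ 2 - b ^ 2)) * hvD
  have hN'ξ : (derivative N).eval ξ = -ξ * (v * (b ^ 2 - a ^ 2)) := by
    rw [hN', hvD]; ring
  have hcrit : (derivative N).eval ξ * Ω.eval ξ = N.eval ξ * (derivative Ω).eval ξ := by
    rw [hN'ξ, hNξ, hΩe, hΩ', ← hv, hWe, hW', hTv]
    field_simp
    ring
  have hξQ : ξ ∉ ZZ a b Q := by
    intro h
    have := hQT v ((mem_ZZ ha hab hQ).1 h)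
    rw [hTv] at this; norm_num at this
  have hΩne := hΩn.eval_ne hξQ
  have hNne : N.eval ξ ≠ 0 := by
    rw [hNξ]
    have : 0 < 1 - v ^ 2 := by linarith
    positivity
  set K := N.eval ξ * Ω.eval ξ / Ω.eval ξ ^ 2 with hK
  have hK0 : K ≠ 0 := div_ne_zero (mul_ne_zero hNne hΩne) (pow_ne_zero 2 hΩne)
  set w : ℝ → ℝ := fun z => N.eval z / (derivative Ω).eval z * (-1 / (ξ - z) ^ 2) with hw
  have formula : ∀ f : ℝ[X], f.natDegree ≤ 2 * m →
      (derivative f).eval ξ * K = ∑ z ∈ ZZ a b Q, f.eval z * w z := by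
    intro f hf
    have h1 : (f * N).natDegree ≤ (ZZ a b Q).card := by
      rw [ZZ_card ha hab hQ, hQc]
      refine natDegree_mul_le.trans ?_
      omega
    have h2 := hΩn.lagrange_deriv h1 hξQ
    have h3 : ∑ z ∈ ZZ a b Q, f.eval z * w z =
        ∑ z ∈ ZZ a b Q, (f * N).eval z / (derivative Ω).eval z * (-1 / (ξ - z) ^ 2) := by
      refine Finset.sum_congr rfl fun z hz => ?_
      rw [hw, eval_mul]; ring
    rw [h3, ← h2, hK, ← mul_div_assoc]
    congr 1
    rw [derivative_mul, eval_add, eval_mul, eval_mul, eval_mul]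
    linear_combination (-f.eval ξ) * hcrit
  have fp := formula p hp
  have ft := formula t (by rw [ht, natDegree_comp, hdeg, VV_natDegree ha hab]; omega)
  have bp : |(derivative p).eval ξ| * |K| ≤ M * ∑ z ∈ ZZ a b Q, |w z| := by
    rw [← abs_mul, fp, Finset.mul_sum]
    refine (Finset.abs_sum_le_sum_abs _ _).trans (Finset.sum_le_sum fun z hz => ?_)
    rw [abs_mul]
    obtain ⟨h1, h2⟩ := ZZ_bound ha hab hQ hz
    exact mul_le_mul_of_nonneg_right (hM z h1 h2) (abs_nonneg _)
  have hsq : ∀ x, a ≤ |x| → |x| ≤ b → (x ^ 2 - a * b) ^ 2 ≤ x ^ 2 * (b - a) ^ 2 := by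
    intro x h1 h2
    have e := sq_abs x
    have h3 : 0 ≤ x ^ 2 - a ^ 2 := by nlinarith
    have h4 : 0 ≤ b ^ 2 - x ^ 2 := by nlinarith
    nlinarith [mul_nonneg h3 h4]
  have hsign : ∀ z ∈ ZZ a b Q, ξ * (t.eval z * w z) ≤ 0 := by
    intro z hz
    obtain ⟨h1, h2⟩ := ZZ_bound ha hab hQ hz
    have hq := (mem_ZZ ha hab hQ).1 hz
    have hpos := hWpos _ hq
    have hO := hΩn.simple hz
    have hzN : 0 ≤ ξ * z * N.eval z := by
      rw [hNe]
      have h5 := hsq z h1 h2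
      have h6 := hsq ξ hξa hξb
      have h7 : ((ξ * z) * ((a * b - ξ ^ 2) * (z ^ 2 - a * b))) ^ 2 ≤
          ((ξ * z) ^ 2 * (b - a) ^ 2) ^ 2 := by
        calc _ = (ξ * z) ^ 2 * ((ξ ^ 2 - a * b) ^ 2 * (z ^ 2 - a * b) ^ 2) := by ring
          _ ≤ (ξ * z) ^ 2 * ((ξ ^ 2 * (b - a) ^ 2) * (z ^ 2 * (b - a) ^ 2)) := by gcongr
          _ = _ := by ring
      have h8 := (abs_le_of_sq_le_sq' h7 (by positivity)).1
      linarith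
    have e : ξ * (t.eval z * w z) =
        -((ξ * z * N.eval z) * (T.eval (vv a b z) * (derivative W).eval (vv a b z)) *
          (4 / (b ^ 2 - a ^ 2)) / ((derivative Ω).eval z ^ 2 * (ξ - z) ^ 2)) := by
      have e1 : (ξ * z * N.eval z) * (T.eval (vv a b z) * (derivative W).eval (vv a b z)) *
          (4 / (b ^ 2 - a ^ 2)) = ξ * N.eval z * T.eval (vv a b z) * (derivative Ω).eval z := by
        rw [hΩ']; ring
      have hxz : ξ - z ≠ 0 := sub_ne_zero.2 (by rintro rfl; exact hξQ hz)
      rw [e1, hw, hte]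
      field_simp
    rw [e]
    refine neg_nonpos.2 (div_nonneg (mul_nonneg (mul_nonneg hzN hpos.le) (by positivity))
      (by positivity))
  have bt : |(derivative t).eval ξ| * |K| = ∑ z ∈ ZZ a b Q, |w z| := by
    have h1 : |ξ| * (|(derivative t).eval ξ| * |K|) = |ξ| * ∑ z ∈ ZZ a b Q, |w z| := by
      rw [← abs_mul, ft, ← abs_mul, Finset.mul_sum, Finset.mul_sum]
      rw [abs_of_nonpos (Finset.sum_nonpos hsign), ← Finset.sum_neg_distrib]
      refine Finset.sum_congr rfl fun z hz => ?_
      rw [← abs_of_nonpos (hsign z hz), abs_mul, abs_mul]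
      have h2 : |t.eval z| = 1 := by
        have := hQT _ ((mem_ZZ ha hab hQ).1 hz)
        rw [hte]
        rw [← sq_abs] at this
        exact (pow_eq_one_iff_of_nonneg (abs_nonneg _) two_ne_zero).1 this
      rw [h2, one_mul]
    exact mul_left_cancel₀ (abs_ne_zero.2 hξ0) h1
  rw [← bt, ← mul_assoc] at bp
  exact le_of_mul_le_mul_right bp (abs_pos.2 hK0)

lemma markov_pointwise {a b : ℝ} (ha : 0 < a) (hab : a < b) {m : ℕ} (hm : 0 < m)
    {p : ℝ[X]} (hp : p.natDegree ≤ 2 * m) {M : ℝ}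
    (hM : ∀ x, a ≤ |x| → |x| ≤ b → |p.eval x| ≤ M)
    {x : ℝ} (hxa : a ≤ |x|) (hxb : |x| ≤ b) :
    |(derivative p).eval x| ≤ (4 * (m : ℝ) ^ 2 * b / (b ^ 2 - a ^ 2)) * M := by
  obtain ⟨T, S, Q, hdeg, hTS, hSc, hQc, hS, hQ, ode, pyth, hQT⟩ := exists_cheb m hm
  have hD := D_pos ha hab
  have hb : 0 < b := ha.trans hab
  have hM0 : 0 ≤ M := (abs_nonneg _).trans (hM x hxa hxb)
  have hS' : ∀ s ∈ S, |s| ≤ 1 := fun s hs => (hS s hs).le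
  have bern : ∀ ξ ∈ ZZ a b S, |(derivative p).eval ξ| ≤
      M * |(derivative (T.comp (VV a b))).eval ξ| := fun ξ hξ =>
    bernstein_at_zero ha hab hm hdeg hTS hSc hQc hS hQ ode pyth hQT hp hM hξ
  set t := T.comp (VV a b) with ht
  have htn : IsNodal t (ZZ a b S) := comp_nodal ha hab hS' hTS
  have hv := vv_abs ha hab hxa hxb
  by_cases hx : x ∈ ZZ a b S
  · refine (bern x hx).trans ?_
    have h1 := key_root hm hTS hS ode pyth ((mem_ZZ ha hab hS').1 hx)
    have h2 : (derivative t).eval x =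
        (derivative T).eval (vv a b x) * (4 * x / (b ^ 2 - a ^ 2)) := by
      rw [ht, derivative_comp, eval_mul, eval_comp, VV_eval, VV_deriv, mul_comm]
    rw [h2, abs_mul, abs_div, abs_mul, abs_of_pos hD, mul_comm]
    refine mul_le_mul_of_nonneg_right ?_ hM0
    calc _ ≤ (m : ℝ) ^ 2 * (|4| * b / (b ^ 2 - a ^ 2)) := by gcongr
      _ = _ := by norm_num; ring
  · have hxS : vv a b x ∉ S := fun h => hx ((mem_ZZ ha hab hS').2 h)
    have hd : (derivative p).degree < (ZZ a b S).card := by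
      rw [ZZ_card ha hab hS', hSc]
      by_cases h0 : derivative p = 0
      · rw [h0, degree_zero]; exact WithBot.bot_lt_coe _
      · rw [degree_eq_natDegree h0]
        have := natDegree_derivative_le p
        exact_mod_cast (by omega : (derivative p).natDegree < 2 * m)
    have h1 := htn.lagrange hd hx
    have htx := htn.eval_ne hx
    have hte : t.eval x = T.eval (vv a b x) := by rw [ht, eval_comp, VV_eval]
    rw [div_eq_iff htx] at h1
    have hsum : |∑ z ∈ ZZ a b S, (derivative p).eval z / (derivative t).eval z * (x - z)⁻¹| ≤
        M * ∑ z ∈ ZZ a b S, |x - z|⁻¹ := by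
      rw [Finset.mul_sum]
      refine (Finset.abs_sum_le_sum_abs _ _).trans (Finset.sum_le_sum fun z hz => ?_)
      rw [abs_mul, abs_inv, abs_div]
      refine mul_le_mul_of_nonneg_right ?_ (by positivity)
      rw [div_le_iff₀ (abs_pos.2 (htn.simple hz))]
      exact bern z hz
    have hsum2 : ∑ z ∈ ZZ a b S, |x - z|⁻¹ ≤
        4 * b / (b ^ 2 - a ^ 2) * ∑ s ∈ S, |vv a b x - s|⁻¹ := by
      rw [ZZ_sum ha hab hS', Finset.mul_sum]
      refine Finset.sum_le_sum fun s hs => ?_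
      obtain ⟨hr1, hr2⟩ := rr_mem ha hab (hS' s hs)
      have hr3 := rr_sq ha hab (hS' s hs)
      set r := rr a b s
      have e1 : vv a b x - s = 2 / (b ^ 2 - a ^ 2) * ((x - r) * (x - -r)) := by
        have : (x - r) * (x - -r) = x ^ 2 - r ^ 2 := by ring
        rw [this, hr3]; unfold vv; field_simp; ring
      have hne : vv a b x - s ≠ 0 := sub_ne_zero.2 (by rintro h; exact hxS (h ▸ hs))
      have hne1 : x - r ≠ 0 := by intro h; rw [e1, h] at hne; simp at hne
      have hne2 : x - -r ≠ 0 := by intro h; rw [e1, h] at hne; simp at hne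
      have h3 : |x - r| + |x - -r| ≤ 2 * b := by
        have := abs_le.1 hxb
        rcases abs_cases (x - r) with h | h <;> rcases abs_cases (x - -r) with h' | h' <;> linarith
      have p1 := abs_pos.2 hne1
      have p2 := abs_pos.2 hne2
      rw [e1, abs_mul, abs_mul, abs_of_pos (by positivity : 0 < 2 / (b ^ 2 - a ^ 2))]
      have e2 : |x - r|⁻¹ + |x - -r|⁻¹ = (|x - r| + |x - -r|) * (|x - r| * |x - -r|)⁻¹ := by
        field_simp; ring
      have e3 : 4 * b / (b ^ 2 - a ^ 2) * (2 / (b ^ 2 - a ^ 2) * (|x - r| * |x - -r|))⁻¹ =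
          2 * b * (|x - r| * |x - -r|)⁻¹ := by
        field_simp; ring
      rw [e2, e3]
      gcongr
    have hk := key_sum hm hTS hS ode pyth hv hxS
    rw [h1, abs_mul, hte]
    calc _ ≤ (M * (4 * b / (b ^ 2 - a ^ 2) * ∑ s ∈ S, |vv a b x - s|⁻¹)) * |T.eval (vv a b x)| := by
          refine mul_le_mul_of_nonneg_right (hsum.trans ?_) (abs_nonneg _)
          gcongr
      _ = M * (4 * b / (b ^ 2 - a ^ 2)) * (|T.eval (vv a b x)| * ∑ s ∈ S, |vv a b x - s|⁻¹) := by
          ring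
      _ ≤ M * (4 * b / (b ^ 2 - a ^ 2)) * (m : ℝ) ^ 2 := by gcongr
      _ = _ := by ring

theorem markov_two_symmetric_intervals
    (a b : ℝ) (ha : 0 < a) (hab : a < b)
    (n : ℕ) (hn : 0 < n) (hne : Even n)
    (p : Polynomial ℝ) (hdeg : p.natDegree ≤ n)
    (E : Set ℝ) (hE : E = Icc (-b) (-a) ∪ Icc a b)
    (hgap : ∀ x ∈ Ioo (-a) a, p.eval x > sSup ((fun t => |p.eval t|) '' E)) :
    sSup ((fun x => |(Polynomial.derivative p).eval x|) '' E) ≤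
      ((n : ℝ)^2 * b / (b^2 - a^2)) * sSup ((fun t => |p.eval t|) '' E) := by
  obtain ⟨m, rfl⟩ := hne
  have hmem : ∀ x, x ∈ E ↔ a ≤ |x| ∧ |x| ≤ b := by
    intro x
    rw [hE]
    simp only [mem_union, mem_Icc]
    constructor
    · rintro (⟨h1, h2⟩ | ⟨h1, h2⟩)
      · rw [abs_of_neg (by linarith)]; constructor <;> linarith
      · rw [abs_of_pos (by linarith)]; exact ⟨h1, h2⟩
    · rintro ⟨h1, h2⟩
      rcases abs_cases x with h | h
      · right; constructor <;> linarith
      · left; constructor <;> linarith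
  have hcomp : IsCompact E := by rw [hE]; exact isCompact_Icc.union isCompact_Icc
  have hbdd : BddAbove ((fun t => |p.eval t|) '' E) :=
    (hcomp.image (by fun_prop : Continuous fun t => |p.eval t|)).bddAbove
  have hEne : E.Nonempty := ⟨a, (hmem a).2 (by rw [abs_of_pos ha]; exact ⟨le_rfl, hab.le⟩)⟩
  refine csSup_le (hEne.image _) ?_
  rintro _ ⟨x, hx, rfl⟩
  obtain ⟨h1, h2⟩ := (hmem x).1 hx
  have := markov_pointwise ha hab (m := m) (by omega) (p := p) (by omega)
    (M := sSup ((fun t => |p.eval t|) '' E))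
    (fun y h1 h2 => le_csSup hbdd ⟨y, (hmem y).2 ⟨h1, h2⟩, rfl⟩) h1 h2
  have e : (((m + m : ℕ) : ℝ)) ^ 2 = 4 * (m : ℝ) ^ 2 := by push_cast; ring
  rw [e]; exact this
end

section
/- Let 0 < a < b be real numbers, let n be a positive even integer, and let E = [−b,−a] ∪ [a,b]. Let p be a real polynomial of degree at most n with sup_{t∈E} |p(t)| = 1 and |p(x)| > 1 for every x ∈ (−a,a). Then for every x ∈ E with |2x² − a² − b²| ≤ (b² − a²)·cos(π/n), one has |p′(x)| ≤ n·|x| / √((b² − x²)(x² − a²)). -/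
open Polynomial Set

theorem rk_bw (W : ℂ[X]) (N : ℕ) (M : ℝ) (hW : W.natDegree ≤ N)
    (h : ∀ θ : ℝ, ‖W.eval (Complex.cos θ)‖ ≤ M) (τ : ℂ) :
    ‖W.eval (Complex.cos τ)‖ ≤ M * Real.exp (N * |τ.im|) := by
  have main : ∀ τ : ℂ, 0 ≤ τ.im → ‖W.eval (Complex.cos τ)‖ ≤ M * Real.exp (N * |τ.im|) := by
    intro τ hτ
    let Q : ℂ → ℂ := fun z => ∑ j ∈ Finset.range (N+1), W.coeff j * ((z^2+1)/2)^j * z^(N-j)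
    have hQ : ∀ σ : ℂ, Q (Complex.exp (σ * Complex.I)) =
        Complex.exp (σ * Complex.I)^N * W.eval (Complex.cos σ) := by
      intro σ
      have h0 := Complex.exp_ne_zero (σ * Complex.I)
      have hc : Complex.exp (σ * Complex.I) * Complex.cos σ =
          (Complex.exp (σ * Complex.I)^2 + 1)/2 := by
        rw [Complex.cos, neg_mul, Complex.exp_neg]; field_simp
      rw [eval_eq_sum_range' (Nat.lt_succ_of_le hW), Finset.mul_sum]
      refine Finset.sum_congr rfl fun j hj => ?_
      have hj' : j ≤ N := Nat.lt_succ_iff.mp (Finset.mem_range.mp hj)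
      rw [← hc, mul_pow]
      conv_rhs => rw [← Nat.sub_add_cancel hj', pow_add]
      ring
    have hd : Differentiable ℂ Q := by
      intro z
      fun_prop
    have hb : ‖Q (Complex.exp (τ * Complex.I))‖ ≤ M := by
      refine Complex.norm_le_of_forall_mem_frontier_norm_le (U := Metric.ball (0:ℂ) 1)
        Metric.isBounded_ball hd.diffContOnCl ?_ ?_
      · intro z hz
        rw [frontier_ball (0:ℂ) one_ne_zero, mem_sphere_zero_iff_norm] at hz
        have : z = Complex.exp ((z.arg : ℂ) * Complex.I) := by
          have := Complex.norm_mul_exp_arg_mul_I z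
          rw [hz] at this; simpa using this.symm
        rw [this, hQ, norm_mul, norm_pow, Complex.norm_exp_ofReal_mul_I, one_pow, one_mul]
        exact h _
      · rw [closure_ball (0:ℂ) one_ne_zero, mem_closedBall_zero_iff, Complex.norm_exp]
        simpa using hτ
    rw [hQ, norm_mul, norm_pow, Complex.norm_exp] at hb
    have e : (τ * Complex.I).re = -τ.im := by simp
    rw [e, ← Real.exp_nat_mul, mul_neg, Real.exp_neg] at hb
    rw [abs_of_nonneg hτ]
    have := Real.exp_pos (N * τ.im)
    rwa [inv_mul_le_iff₀ this, mul_comm] at hb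
  rcases le_total 0 τ.im with h1 | h1
  · exact main τ h1
  · have := main (-τ) (by simpa using h1)
    simpa using this

theorem rk_even (r : ℂ[X]) (N : ℕ) (hr : r.comp (-X) = r) (hN : r.natDegree ≤ 2 * N) :
    ∃ A : ℂ[X], A.natDegree ≤ N ∧ ∀ z, r.eval z = A.eval (z^2) := by
  have hodd : ∀ k, ¬ 2 ∣ k → r.coeff k = 0 := by
    intro k hk
    have h1 : (r.comp (-X)).coeff k = (-1)^k * r.coeff k := by
      have e : (-X : ℂ[X]) = C (-1) * X := by simp
      rw [e, comp_C_mul_X_coeff, mul_comm]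
    rw [hr, Odd.neg_one_pow (by simpa [Nat.odd_iff] using hk)] at h1
    have : (2:ℂ) * r.coeff k = 0 := by linear_combination h1
    simpa using this
  have he : r = expand ℂ 2 (contract 2 r) := by
    ext k
    rw [coeff_expand (by norm_num)]
    split_ifs with hk
    · rw [coeff_contract (by norm_num), Nat.div_mul_cancel hk]
    · exact hodd k hk
  refine ⟨contract 2 r, ?_, fun z => ?_⟩
  · rw [he, natDegree_expand] at hN; omega
  · conv_lhs => rw [he]
    rw [expand_eval]

theorem rk_pow (u v : ℂ) (K : ℝ) (h1 : ‖u * v‖ ≤ 1) (h2 : ∀ k : ℕ, ‖u^k + v^k‖ ≤ K) : ‖u‖ ≤ 1 := by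
  by_contra! hu
  have hv : ‖v‖ ≤ 1 := by
    rw [norm_mul] at h1
    nlinarith [norm_nonneg v]
  obtain ⟨k, hk⟩ := pow_unbounded_of_one_lt (K + 1) hu
  have h3 := h2 k
  have h4 : ‖u^k‖ ≤ ‖u^k + v^k‖ + ‖v^k‖ := by
    simpa using norm_sub_le (u^k + v^k) (v^k)
  have h5 : ‖v^k‖ ≤ 1 := by rw [norm_pow]; exact pow_le_one₀ (norm_nonneg _) hv
  rw [norm_pow] at h4
  linarith

theorem rk_bwE_aux (c d : ℝ) (r : ℂ[X]) (N : ℕ) (M : ℝ) (hr : r.comp (-X) = r)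
    (hN : r.natDegree ≤ 2 * N)
    (h : ∀ (z : ℂ) (θ : ℝ), z^2 = c + d * Complex.cos θ → ‖r.eval z‖ ≤ M)
    (z τ : ℂ) (hz : z^2 = c + d * Complex.cos τ) :
    ‖r.eval z‖ ≤ M * Real.exp (N * |τ.im|) := by
  obtain ⟨A, hA, hAe⟩ := rk_even r N hr hN
  have key := rk_bw (A.comp (C (c:ℂ) + C (d:ℂ) * X)) N M ?_ ?_ τ
  · rw [hAe, hz]; simpa using key
  · refine natDegree_comp_le.trans ?_
    have : (C (c:ℂ) + C (d:ℂ) * X).natDegree ≤ 1 := by compute_degree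
    nlinarith
  · intro θ
    obtain ⟨y, hy⟩ := IsAlgClosed.exists_pow_nat_eq ((c:ℂ) + d * Complex.cos θ) (n := 2) (by norm_num)
    have := h y θ hy
    rw [hAe, hy] at this; simpa using this

theorem rk_bwE (c d : ℝ) (q : ℂ[X]) (m : ℕ)
    (hN : q.natDegree ≤ 2 * m)
    (h : ∀ (z : ℂ) (θ : ℝ), z^2 = c + d * Complex.cos θ → ‖q.eval z‖ ≤ 1)
    (z τ : ℂ) (hz : z^2 = c + d * Complex.cos τ) :
    ‖q.eval z‖ ≤ Real.exp (m * |τ.im|) := by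
  have hdeg : (q.comp (-X)).natDegree ≤ 2 * m := by
    refine natDegree_comp_le.trans ?_
    simpa using hN
  have hcc : (q.comp (-X)).comp (-X) = q := by
    rw [comp_assoc]; simp
  have h' : ∀ (z : ℂ) (θ : ℝ), z^2 = c + d * Complex.cos θ → ‖q.eval (-z)‖ ≤ 1 := by
    intro z θ hz; exact h (-z) θ (by simpa using hz)
  set e := Real.exp (m * |τ.im|) with he
  have hepos : 0 < e := Real.exp_pos _
  have hprod := rk_bwE_aux c d (q * q.comp (-X)) (2*m) 1 ?_ ?_ ?_ z τ hz
  have hsum : ∀ k : ℕ, ‖(q.eval z)^k + (q.eval (-z))^k‖ ≤ 2 * e^k := by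
    intro k
    have hs := rk_bwE_aux c d (q^k + (q.comp (-X))^k) (k*m) 2 ?_ ?_ ?_ z τ hz
    · have e1 : Real.exp (((k * m : ℕ):ℝ) * |τ.im|) = e^k := by
        rw [he, ← Real.exp_nat_mul]; push_cast; ring_nf
      rw [e1] at hs
      simpa using hs
    · simp only [add_comp, pow_comp, hcc]; ring
    · refine (natDegree_add_le _ _).trans (max_le ?_ ?_)
      · refine natDegree_pow_le.trans ?_
        nlinarith
      · refine natDegree_pow_le.trans ?_
        nlinarith
    · intro z θ hz
      have a1 := pow_le_one₀ (n := k) (norm_nonneg _) (h z θ hz)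
      have a2 := pow_le_one₀ (n := k) (norm_nonneg _) (h' z θ hz)
      rw [← norm_pow] at a1 a2
      have := norm_add_le ((q.eval z)^k) ((q.eval (-z))^k)
      have t : ‖(q.eval z)^k + (q.eval (-z))^k‖ ≤ 2 := by linarith
      simpa using t
  · have hfin := rk_pow (q.eval z / e) (q.eval (-z) / e) 2 ?_ ?_
    · rw [norm_div, Complex.norm_real, Real.norm_of_nonneg hepos.le, div_le_one hepos] at hfin
      exact hfin
    · have e1 : Real.exp (((2 * m : ℕ):ℝ) * |τ.im|) = e * e := by
        rw [he, ← Real.exp_add]; push_cast; ring_nf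
      rw [e1] at hprod
      rw [div_mul_div_comm, norm_div, norm_mul (e:ℂ), Complex.norm_real,
        Real.norm_of_nonneg hepos.le, div_le_one (by positivity)]
      simpa using hprod
    · intro k
      rw [div_pow, div_pow, ← add_div, norm_div, norm_pow (e:ℂ), Complex.norm_real,
        Real.norm_of_nonneg hepos.le, div_le_iff₀ (by positivity)]
      exact hsum k
  · rw [mul_comp, hcc]; ring
  · refine natDegree_mul_le.trans ?_
    omega
  · intro z θ hz
    have := mul_le_one₀ (h z θ hz) (norm_nonneg _) (h' z θ hz)
    simpa using this

theorem rk_im (c d : ℝ) (p : ℝ[X]) (m : ℕ) (hN : p.natDegree ≤ 2 * m)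
    (h : ∀ (z : ℂ) (θ : ℝ), z^2 = c + d * Complex.cos θ →
      ∃ y : ℝ, |y| ≤ 1 ∧ (p.map Complex.ofRealHom).eval z = y)
    (z τ : ℂ) (hz : z^2 = c + d * Complex.cos τ) :
    |((p.map Complex.ofRealHom).eval z).im| ≤ Real.sinh (m * |τ.im|) := by
  obtain ⟨χ, hχ⟩ := Complex.cos_surjective ((p.map Complex.ofRealHom).eval z)
  have hk : ∀ k : ℕ, ‖Complex.cos (k * χ)‖ ≤ Real.exp (k * (m * |τ.im|)) := by
    intro k
    have := rk_bwE c d ((Chebyshev.T ℂ k).comp (p.map Complex.ofRealHom)) (k * m) ?_ ?_ z τ hz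
    · rw [eval_comp, ← hχ, Chebyshev.T_complex_cos] at this
      push_cast at this
      rwa [mul_assoc] at this
    · refine natDegree_comp_le.trans ?_
      rw [Chebyshev.natDegree_T, Int.natAbs_natCast]
      have : (p.map Complex.ofRealHom).natDegree ≤ 2 * m := natDegree_map_le.trans hN
      nlinarith
    · intro z θ hz
      obtain ⟨y, hy, hyz⟩ := h z θ hz
      rw [abs_le] at hy
      rw [eval_comp, hyz, ← Real.cos_arccos hy.1 hy.2, Complex.ofReal_cos, Chebyshev.T_complex_cos]
      have : Complex.cos (((k:ℤ):ℂ) * (Real.arccos y : ℂ)) = ((Real.cos (k * Real.arccos y) : ℝ) : ℂ) := by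
        push_cast; rfl
      rw [this, Complex.norm_real]
      exact Real.abs_cos_le_one _
  have him : |χ.im| ≤ m * |τ.im| := by
    by_contra! hlt
    set s := m * |τ.im| with hs
    have hpos : 0 < |χ.im| - s := by linarith
    have hs0 : 0 ≤ s := by positivity
    obtain ⟨k, hk2⟩ := exists_nat_gt (3 / (|χ.im| - s))
    rw [div_lt_iff₀ hpos] at hk2
    have h1 := hk k
    have h2 : Real.sinh (k * |χ.im|) ≤ ‖Complex.cos (k * χ)‖ := by
      have : ‖Complex.cos (k * χ)‖^2 = Real.cos (k * χ.re)^2 + Real.sinh (k * χ.im)^2 := by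
        rw [Complex.cos_eq, Complex.sq_norm, Complex.normSq_apply]
        have r1 : ((k:ℂ) * χ).re = k * χ.re := by simp
        have r2 : ((k:ℂ) * χ).im = k * χ.im := by simp
        rw [r1, r2]
        simp only [← Complex.ofReal_cos, ← Complex.ofReal_sin, ← Complex.ofReal_cosh, ← Complex.ofReal_sinh, ← Complex.ofReal_mul]
        simp only [Complex.sub_re, Complex.sub_im, Complex.ofReal_re, Complex.ofReal_im, Complex.mul_re, Complex.mul_im, Complex.I_re, Complex.I_im]
        have := Real.cosh_sq (k * χ.im)
        have := Real.sin_sq_add_cos_sq (k * χ.re)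
        grind
      have h3 : Real.sinh (k * |χ.im|) = |Real.sinh (k * χ.im)| := by
        rw [Real.abs_sinh, abs_mul, Nat.abs_cast]
      rw [h3, ← abs_of_nonneg (norm_nonneg (Complex.cos (k * χ)))]
      apply sq_le_sq.mp
      nlinarith [sq_nonneg (Real.cos (k * χ.re))]
    have h4 : Real.exp (k * |χ.im|) = Real.exp (k * s) * Real.exp (k * (|χ.im| - s)) := by
      rw [← Real.exp_add]; ring_nf
    have h5 := Real.add_one_le_exp (k * (|χ.im| - s))
    have h6 : 1 ≤ Real.exp (k * s) := Real.one_le_exp (by positivity)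
    have h7 : Real.exp (-(k * |χ.im|)) ≤ 1 := Real.exp_le_one_iff.mpr (by simp; positivity)
    rw [Real.sinh_eq, h4] at h2
    nlinarith
  have : (Complex.cos χ).im = - (Real.sin χ.re * Real.sinh χ.im) := by
    rw [Complex.cos_eq]
    simp only [← Complex.ofReal_cos, ← Complex.ofReal_sin, ← Complex.ofReal_cosh, ← Complex.ofReal_sinh, ← Complex.ofReal_mul]
    simp only [Complex.sub_im, Complex.ofReal_re, Complex.ofReal_im, Complex.mul_im, Complex.I_re, Complex.I_im]
    ring
  rw [← hχ, this, abs_neg, abs_mul, Real.abs_sinh]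
  have h1 := Real.abs_sin_le_one χ.re
  have h2 := Real.sinh_le_sinh.mpr him
  have h3 : 0 ≤ Real.sinh |χ.im| := Real.sinh_nonneg_iff.mpr (abs_nonneg _)
  nlinarith [abs_nonneg (Real.sin χ.re)]

theorem rk_deriv_le (f : ℝ → ℝ) (D m : ℝ) (hf : HasDerivAt f D 0) (h0 : f 0 = 0)
    (hb : ∀ t, |f t| ≤ Real.sinh (m * |t|)) : |D| ≤ m := by
  have h1 : Filter.Tendsto (fun t => |t⁻¹ * f t|) (nhdsWithin 0 (Ioi 0)) (nhds |D|) := by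
    have := (hf.tendsto_slope_zero_right).abs
    simpa [h0] using this
  have hs : HasDerivAt (fun t : ℝ => Real.sinh (m * t)) m 0 := by
    have := ((hasDerivAt_id (0:ℝ)).const_mul m).sinh
    simpa using this
  have h2 : Filter.Tendsto (fun t => t⁻¹ * Real.sinh (m * t)) (nhdsWithin 0 (Ioi 0)) (nhds m) := by
    have := hs.tendsto_slope_zero_right
    simpa using this
  refine le_of_tendsto_of_tendsto h1 h2 ?_
  filter_upwards [self_mem_nhdsWithin] with t ht
  have ht : 0 < t := ht
  have := hb t
  rw [abs_of_pos ht] at this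
  rw [abs_mul, abs_of_pos (inv_pos.mpr ht)]
  gcongr

theorem rk_local (c d x θ : ℝ) (hx : x ≠ 0) (hxc : x^2 = c + d * Real.cos θ) (p : ℝ[X]) (m : ℕ)
    (hN : p.natDegree ≤ 2 * m)
    (h : ∀ (z : ℂ) (θ : ℝ), z^2 = c + d * Complex.cos θ →
      ∃ y : ℝ, |y| ≤ 1 ∧ (p.map Complex.ofRealHom).eval z = y) :
    |(derivative p).eval x * (d * Real.sin θ / (2 * x))| ≤ m := by
  have hxC : (x:ℂ) ≠ 0 := by exact_mod_cast hx
  have hxcC : (x:ℂ)^2 = c + d * Complex.cos θ := by exact_mod_cast hxc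
  let g : ℝ → ℂ := fun t => (c + d * Complex.cos (θ + t * Complex.I)) / x^2
  let Z : ℝ → ℂ := fun t => x * (g t)^(1/2 : ℂ)
  have hg0 : g 0 = 1 := by
    simp only [g, Complex.ofReal_zero, zero_mul, add_zero]
    rw [← hxcC]; field_simp
  have hZ0 : Z 0 = x := by simp [Z, hg0]
  have hZ2 : ∀ t, (Z t)^2 = c + d * Complex.cos (θ + t * Complex.I) := by
    intro t
    have : ((g t)^(1/2 : ℂ))^2 = g t := by
      rw [one_div]
      exact_mod_cast Complex.cpow_nat_inv_pow (g t) (n := 2) (by norm_num)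
    simp only [Z]
    rw [mul_pow, this]
    simp only [g]
    field_simp
  have hgd : HasDerivAt g (d * (-Complex.sin θ * Complex.I) / x^2) 0 := by
    have h1 : HasDerivAt (fun t : ℝ => (θ:ℂ) + t * Complex.I) Complex.I 0 := by
      have := ((Complex.ofRealCLM.hasDerivAt (x := (0:ℝ))).mul_const Complex.I).const_add (θ:ℂ)
      simpa using this
    have h2 : HasDerivAt (fun t : ℝ => Complex.cos ((θ:ℂ) + t * Complex.I)) (-Complex.sin θ * Complex.I) 0 := by
      have := (Complex.hasDerivAt_cos ((θ:ℂ) + (0:ℝ) * Complex.I)).comp (0:ℝ) h1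
      simpa [Function.comp_def] using this
    exact ((h2.const_mul (d:ℂ)).const_add (c:ℂ)).div_const _
  have hZd : HasDerivAt Z (-(d * Complex.sin θ / (2 * x)) * Complex.I) 0 := by
    have h1 : HasDerivAt (fun w : ℂ => w^(1/2:ℂ)) (1/2) (g 0) := by
      rw [hg0]
      have := (hasDerivAt_id (1:ℂ)).cpow_const (c := (1/2:ℂ)) (by simp)
      simpa using this
    have h2 := (h1.comp (0:ℝ) hgd).const_mul (x:ℂ)
    have e : (-(d * Complex.sin θ / (2 * x)) * Complex.I : ℂ) =
        x * (1/2 * (d * (-Complex.sin θ * Complex.I) / x^2)) := by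
      field_simp
    rw [e]
    exact h2
  have hP : HasDerivAt (fun t => (p.map Complex.ofRealHom).eval (Z t))
      ((((derivative p).eval x : ℝ) : ℂ) * (-(d * Complex.sin θ / (2 * x)) * Complex.I)) 0 := by
    have h1 := ((p.map Complex.ofRealHom).hasDerivAt (Z 0)).comp (0:ℝ) hZd
    rw [hZ0, derivative_map] at h1
    have e : eval (x:ℂ) (map Complex.ofRealHom (derivative p)) = (((derivative p).eval x : ℝ) : ℂ) := by
      exact eval_map_apply (f := Complex.ofRealHom) (p := derivative p) x
    rw [e] at h1
    exact h1
  have hI : HasDerivAt (fun t => ((p.map Complex.ofRealHom).eval (Z t)).im)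
      (-((derivative p).eval x * (d * Real.sin θ / (2 * x)))) 0 := by
    have h1 := (Complex.imCLM.hasFDerivAt).comp_hasDerivAt (0:ℝ) hP
    have : (((derivative p).eval x : ℝ) : ℂ) * (-(d * Complex.sin θ / (2 * x)) * Complex.I)
      = ((-((derivative p).eval x * (d * Real.sin θ / (2 * x))) : ℝ) : ℂ) * Complex.I := by
      push_cast; ring
    rw [this, Complex.imCLM_apply, Complex.im_ofReal_mul, Complex.I_im, mul_one] at h1
    exact h1
  rw [← abs_neg]
  refine rk_deriv_le _ _ _ hI ?_ ?_
  · simp only [hZ0]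
    have : eval (x:ℂ) (map Complex.ofRealHom p) = ((p.eval x : ℝ) : ℂ) :=
      eval_map_apply (f := Complex.ofRealHom) (p := p) x
    rw [this, Complex.ofReal_im]
  · intro t
    have := rk_im c d p m hN h (Z t) (θ + t * Complex.I) (hZ2 t)
    simpa using this

theorem rusak_inequality_inner_part
    (a b : ℝ) (ha : 0 < a) (hab : a < b)
    (n : ℕ) (hn : 0 < n) (hne : Even n)
    (E : Set ℝ) (hE : E = Icc (-b) (-a) ∪ Icc a b)
    (p : Polynomial ℝ) (hdeg : p.natDegree ≤ n)
    (hnorm : sSup ((fun t => |p.eval t|) '' E) = 1)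
    (hgap : ∀ x ∈ Ioo (-a) a, |p.eval x| > 1) :
    ∀ x ∈ E, |2 * x ^ 2 - a ^ 2 - b ^ 2| ≤ (b ^ 2 - a ^ 2) * Real.cos (Real.pi / n) →
      |(Polynomial.derivative p).eval x| ≤
        (n : ℝ) * |x| / Real.sqrt ((b ^ 2 - x ^ 2) * (x ^ 2 - a ^ 2)) := by
  intro x hxE hx
  have hEc : IsCompact E := by rw [hE]; exact isCompact_Icc.union isCompact_Icc
  have hbd : ∀ y ∈ E, |p.eval y| ≤ 1 := by
    intro y hy
    rw [← hnorm]
    refine le_csSup ?_ (mem_image_of_mem _ hy)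
    exact (hEc.image (by fun_prop)).bddAbove
  obtain ⟨m, hm⟩ := hne
  have hn2 : (2:ℝ) ≤ n := by
    have : 2 ≤ n := by omega
    exact_mod_cast this
  have hd : 0 < b^2 - a^2 := by nlinarith
  have hcos : Real.cos (Real.pi / n) < 1 := by
    rw [← Real.cos_zero]
    refine Real.cos_lt_cos_of_nonneg_of_le_pi le_rfl ?_ (by positivity)
    exact div_le_self Real.pi_pos.le (by linarith)
  have hlt : |2 * x ^ 2 - a ^ 2 - b ^ 2| < b^2 - a^2 := by nlinarith
  rw [abs_lt] at hlt
  have hx1 : a^2 < x^2 := by linarith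
  have hx2 : x^2 < b^2 := by linarith
  have hx0 : x ≠ 0 := by rintro rfl; nlinarith
  let w := (2 * x^2 - a^2 - b^2) / (b^2 - a^2)
  have hw1 : -1 ≤ w := by
    simp only [w]; rw [le_div_iff₀ hd]; linarith
  have hw2 : w ≤ 1 := by
    simp only [w]; rw [div_le_iff₀ hd]; linarith
  have key := rk_local ((a^2+b^2)/2) ((b^2-a^2)/2) x (Real.arccos w) hx0 ?_ p m (by omega) ?_
  · rw [Real.sin_arccos] at key
    have hs : (b^2-a^2)/2 * √(1 - w^2) = √((b ^ 2 - x ^ 2) * (x ^ 2 - a ^ 2)) := by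
      rw [← Real.sqrt_sq (show 0 ≤ (b^2-a^2)/2 by linarith), ← Real.sqrt_mul (sq_nonneg _)]
      congr 1
      simp only [w]
      field_simp
      ring
    rw [hs] at key
    have hpos : 0 < (b ^ 2 - x ^ 2) * (x ^ 2 - a ^ 2) := mul_pos (by linarith) (by linarith)
    have hsp := Real.sqrt_pos.mpr hpos
    rw [abs_mul, abs_div, abs_of_pos hsp, abs_mul, abs_two, ← mul_div_assoc,
      div_le_iff₀ (by positivity)] at key
    rw [le_div_iff₀ hsp]
    have : (n:ℝ) = m + m := by exact_mod_cast hm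
    rw [this]; linarith
  · rw [Real.cos_arccos hw1 hw2]
    simp only [w]
    field_simp
    ring
  · intro z θ hz
    have c1 := Real.neg_one_le_cos θ
    have c2 := Real.cos_le_one θ
    set s := (a^2+b^2)/2 + (b^2-a^2)/2 * Real.cos θ with hs
    have hs1 : a^2 ≤ s := by nlinarith
    have hs2 : s ≤ b^2 := by nlinarith
    have hs3 : a ≤ √s := Real.le_sqrt_of_sq_le hs1
    have hs4 : √s ≤ b := Real.sqrt_le_iff.mpr ⟨by linarith, hs2⟩
    have hz' : z^2 = ((√s : ℝ) : ℂ)^2 := by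
      rw [hz, ← Complex.ofReal_pow, Real.sq_sqrt (by nlinarith), hs]
      push_cast; rfl
    have ev : ∀ y : ℝ, eval (y:ℂ) (map Complex.ofRealHom p) = ((p.eval y : ℝ) : ℂ) := fun y =>
      eval_map_apply (f := Complex.ofRealHom) (p := p) y
    rcases sq_eq_sq_iff_eq_or_eq_neg.mp hz' with h | h
    · refine ⟨p.eval (√s), hbd _ ?_, ?_⟩
      · rw [hE]; exact Or.inr ⟨hs3, hs4⟩
      · rw [h, ev]
    · refine ⟨p.eval (-√s), hbd _ ?_, ?_⟩
      · rw [hE]; exact Or.inl ⟨by linarith, by linarith⟩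
      · rw [h, ← Complex.ofReal_neg, ev]
end

section
/- Let 0 < a < b be real numbers, let n be a positive even integer, and let E = [−b,−a] ∪ [a,b]. Let p be a real polynomial of degree at most n with sup_{t∈E} |p(t)| = 1 and |p(x)| > 1 for every x ∈ (−a,a). Then for every x ∈ E with |2x² − a² − b²| ≥ (b² − a²)·cos(π/n), one has |p′(x)| ≤ |S_n′(x)|, where S_n(x) = T_{n/2}((2x² − a² − b²)/(b² − a²)). -/
open Polynomial Set

lemma rk_interp (s : Finset ℝ) (W p : ℝ[X]) (hWd : W.natDegree ≤ s.card)
    (hW : ∀ y ∈ s, W.eval y = 0) (d : ℝ) (hd : d ∈ s) (hp : p.natDegree + 2 ≤ s.card)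
    (x : ℝ) (hx : W.eval x ≠ 0) :
    (derivative p).eval x = ∑ y ∈ s.erase d, p.eval y * ((y - d) / (derivative W).eval y *
      (W.eval x / ((x - d) * (x - y)) *
        ((derivative W).eval x / W.eval x - 1 / (x - d) - 1 / (x - y)))) := by
  classical
  have hxs : ∀ y ∈ s, x - y ≠ 0 := by
    intro y hy h
    apply hx
    rw [sub_eq_zero.mp h]; exact hW y hy
  have hinj : Set.InjOn (id : ℝ → ℝ) (s.erase d : Finset ℝ) := Function.injective_id.injOn
  have hcard : (s.erase d).card = s.card - 1 := Finset.card_erase_of_mem hd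
  -- W = κ * nodal
  have hdvd : Lagrange.nodal s (id : ℝ → ℝ) ∣ W := by
    rw [Lagrange.nodal_eq]
    apply Finset.prod_dvd_of_coprime
    · intro i _ j _ hij
      exact Polynomial.pairwise_coprime_X_sub_C Function.injective_id hij
    · intro i hi
      exact Polynomial.dvd_iff_isRoot.mpr (hW i hi)
  obtain ⟨q, hq⟩ := hdvd
  have hW0 : W ≠ 0 := by rintro rfl; simp at hx
  have hq0 : q ≠ 0 := by rintro rfl; simp at hq; exact hW0 hq
  have hqd : q.natDegree = 0 := by
    have h1 := congrArg natDegree hq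
    rw [natDegree_mul Lagrange.nodal_ne_zero hq0, Lagrange.natDegree_nodal] at h1
    omega
  obtain ⟨κ, rfl⟩ := natDegree_eq_zero.mp hqd
  have hκ : κ ≠ 0 := by rintro rfl; simp at hq0
  set N := Lagrange.nodal (s.erase d) (id : ℝ → ℝ) with hN
  have hWN : W = C κ * ((X - C d) * N) := by
    rw [hq, Lagrange.nodal_eq_mul_nodal_erase hd]; simp only [id]; ring
  have hdW : ∀ t, (derivative W).eval t = κ * (N.eval t + (t - d) * (derivative N).eval t) := by
    intro t; rw [hWN]; simp [derivative_mul]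
  have hWe : ∀ t, W.eval t = κ * ((t - d) * N.eval t) := by
    intro t; rw [hWN]; simp
  have hNx : N.eval x ≠ 0 := by
    intro h; apply hx; rw [hWe, h]; ring
  have hdeg : p.degree < ((s.erase d).card : ℕ) := by
    apply lt_of_le_of_lt degree_le_natDegree
    rw [hcard]; exact_mod_cast (by omega)
  have hpi := Lagrange.eq_interpolate hinj hdeg
  conv_lhs => rw [hpi]
  rw [Lagrange.interpolate_apply, derivative_sum, eval_finsetSum]
  apply Finset.sum_congr rfl
  intro y hy
  have hys : y ∈ s := Finset.mem_of_mem_erase hy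
  have hyd : y - d ≠ 0 := sub_ne_zero.mpr (Finset.ne_of_mem_erase hy)
  have hxy := hxs y hys
  have hxd := hxs d hd
  have hNy : N.eval y = 0 := Lagrange.eval_nodal_at_node (v := id) hy
  have hb : Lagrange.basis (s.erase d) id y * (X - C y) =
      C (Lagrange.nodalWeight (s.erase d) id y) * N := by
    rw [Lagrange.basis_eq_prod_sub_inv_mul_nodal_div hy, hN,
      ← Lagrange.nodal_erase_eq_nodal_div hy, Lagrange.nodal_eq_mul_nodal_erase hy]
    simp only [id]; ring
  have hw : Lagrange.nodalWeight (s.erase d) id y = ((derivative N).eval y)⁻¹ := 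
    Lagrange.nodalWeight_eq_eval_derivative_nodal hy
  have hw0 := Lagrange.nodalWeight_ne_zero hinj hy
  have hN'y : (derivative N).eval y ≠ 0 := by
    intro h; rw [hw, h] at hw0; simp at hw0
  have hb1 := congrArg (eval x) hb
  have hb2 := congrArg (fun r => eval x (derivative r)) hb
  simp [derivative_mul] at hb1 hb2
  rw [hw] at hb1 hb2
  have e1 : (Lagrange.basis (s.erase d) id y).eval x = ((derivative N).eval y)⁻¹ * N.eval x / (x - y) := by
    rw [eq_div_iff hxy, hb1]
  have e2 : (derivative (Lagrange.basis (s.erase d) id y)).eval x =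
     (((derivative N).eval y)⁻¹ * (derivative N).eval x - ((derivative N).eval y)⁻¹ * N.eval x / (x - y)) / (x-y) := by
    rw [eq_div_iff hxy, ← hb2, e1]; ring
  simp only [derivative_C_mul, eval_mul, eval_C, id]
  congr 1
  rw [e2, hdW y, hdW x, hWe x, hNy]
  field_simp
  ring

lemma rk_T_cos (m : ℕ) (θ : ℝ) : (Chebyshev.T ℝ (m:ℤ)).eval (Real.cos θ) = Real.cos (m * θ) := by
  simp

lemma rk_dT_cos (m : ℕ) (θ : ℝ) :
    (derivative (Chebyshev.T ℝ (m:ℤ))).eval (Real.cos θ) * Real.sin θ = m * Real.sin (m * θ) := by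
  rw [Chebyshev.T_derivative_eq_U]
  have := Chebyshev.U_real_cos θ ((m:ℤ) - 1)
  simp only [Int.cast_sub, Int.cast_natCast, Int.cast_one, sub_add_cancel] at this
  simp [mul_assoc, this]

lemma rk_ode (m : ℕ) (v : ℝ) :
    (1 - v ^ 2) * (derivative (derivative (Chebyshev.T ℝ (m:ℤ)))).eval v =
      v * (derivative (Chebyshev.T ℝ (m:ℤ))).eval v - m ^ 2 * (Chebyshev.T ℝ (m:ℤ)).eval v := by
  have := congrArg (eval v) (Chebyshev.one_sub_X_sq_mul_derivative_derivative_T_eq_poly_in_T (R := ℝ) (m:ℤ))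
  simp at this
  linarith

lemma rk_trig (m : ℕ) (hm : 1 ≤ m) (θ : ℝ) (h0 : 0 ≤ θ) (h1 : m * θ ≤ Real.pi) :
    0 ≤ Real.cos θ * Real.sin (m * θ) - m * Real.sin θ * Real.cos (m * θ) := by
  have hm' : (1:ℝ) ≤ m := by exact_mod_cast hm
  have hmono : MonotoneOn (fun t : ℝ => Real.cos t * Real.sin (m * t) - m * Real.sin t * Real.cos (m * t))
      (Icc 0 θ) := by
    apply monotoneOn_of_hasDerivWithinAt_nonneg (convex_Icc 0 θ)
      (f' := fun t => ((m:ℝ) ^ 2 - 1) * (Real.sin t * Real.sin (m * t))) (by fun_prop)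
    · intro t _
      apply HasDerivAt.hasDerivWithinAt
      have hl : HasDerivAt (fun t : ℝ => (m:ℝ) * t) m t := by simpa using (hasDerivAt_id t).const_mul (m:ℝ)
      have := ((Real.hasDerivAt_cos t).mul hl.sin).sub (((Real.hasDerivAt_sin t).const_mul (m:ℝ)).mul hl.cos)
      refine HasDerivAt.congr_deriv (f' := _) this ?_
      ring
    · intro t ht
      rw [interior_Icc] at ht
      have hmt : (m:ℝ) * t ≤ m * θ := by have := ht.2.le; gcongr
      have htm : t ≤ m * t := by nlinarith [ht.1]
      apply mul_nonneg (by nlinarith)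
      apply mul_nonneg
      · exact Real.sin_nonneg_of_nonneg_of_le_pi ht.1.le (by linarith)
      · exact Real.sin_nonneg_of_nonneg_of_le_pi (by linarith [ht.1]) (by linarith)
  have := hmono (left_mem_Icc.mpr h0) (right_mem_Icc.mpr h0) h0
  simpa using this

lemma rk_cheb (m : ℕ) (hm : 1 ≤ m) (v : ℝ) (hv : Real.cos (Real.pi / (2 * m)) ≤ v) (hv1 : v < 1) :
    0 ≤ (Chebyshev.T ℝ (m:ℤ)).eval v ∧ 0 < (derivative (Chebyshev.T ℝ (m:ℤ))).eval v ∧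
    m ^ 2 * (Chebyshev.T ℝ (m:ℤ)).eval v ≤ v * (derivative (Chebyshev.T ℝ (m:ℤ))).eval v := by
  have hm' : (1:ℝ) ≤ m := by exact_mod_cast hm
  have hpi := Real.pi_pos
  have hA : Real.pi / (2 * m) ≤ Real.pi / 2 := by gcongr; linarith
  have hA0 : 0 < Real.pi / (2 * m) := by positivity
  have hv0 : 0 ≤ v := le_trans (Real.cos_nonneg_of_mem_Icc ⟨by linarith, hA⟩) hv
  obtain ⟨θ, hθ0, hθ1, rfl⟩ : ∃ θ, 0 < θ ∧ θ ≤ Real.pi / (2 * m) ∧ Real.cos θ = v := by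
    refine ⟨Real.arccos v, Real.arccos_pos.mpr hv1, ?_, Real.cos_arccos (by linarith) hv1.le⟩
    have := Real.arccos_le_arccos hv
    rwa [Real.arccos_cos hA0.le (by linarith)] at this
  have hmθ : m * θ ≤ Real.pi / 2 := by
    calc m * θ ≤ m * (Real.pi / (2 * m)) := by gcongr
      _ = _ := by field_simp
  have hmθ0 : 0 < m * θ := by positivity
  have hs : 0 < Real.sin θ := Real.sin_pos_of_pos_of_lt_pi hθ0 (by linarith)
  have hsm : 0 < Real.sin (m * θ) := Real.sin_pos_of_pos_of_lt_pi hmθ0 (by linarith)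
  have hd := rk_dT_cos m θ
  refine ⟨?_, ?_, ?_⟩
  · rw [rk_T_cos]; exact Real.cos_nonneg_of_mem_Icc ⟨by linarith, hmθ⟩
  · refine (mul_pos_iff_of_pos_right hs).mp ?_
    rw [hd]; positivity
  · refine le_of_mul_le_mul_right ?_ hs
    rw [mul_assoc (Real.cos θ), hd, rk_T_cos]
    have := rk_trig m hm θ hθ0.le (by linarith)
    nlinarith

lemma rk_cheb_neg (m : ℕ) (hm : 1 ≤ m) (v : ℝ) (hv : v ≤ -Real.cos (Real.pi / (2 * m))) (hv1 : -1 < v) :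
    ∃ ε : ℝ, (ε = 1 ∨ ε = -1) ∧ (Chebyshev.T ℝ (m:ℤ)).eval (-1) = ε ∧ 
    0 ≤ ε * (Chebyshev.T ℝ (m:ℤ)).eval v ∧ ε * (derivative (Chebyshev.T ℝ (m:ℤ))).eval v < 0 ∧
    0 ≤ ε * (v * (derivative (Chebyshev.T ℝ (m:ℤ))).eval v - m ^ 2 * (Chebyshev.T ℝ (m:ℤ)).eval v) := by
  obtain ⟨h1, h2, h3⟩ := rk_cheb m hm (-v) (by linarith) (by linarith)
  have e1 : ∀ w, (Chebyshev.T ℝ (m:ℤ)).eval (-w) = (-1) ^ m * (Chebyshev.T ℝ (m:ℤ)).eval w := by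
    intro w
    rw [Chebyshev.T_eval_neg]; simp
  have e2 : (derivative (Chebyshev.T ℝ (m:ℤ))).eval (-v) = -(-1) ^ m * (derivative (Chebyshev.T ℝ (m:ℤ))).eval v := by
    have : (Chebyshev.T ℝ (m:ℤ)).comp (-X) = C ((-1)^m) * Chebyshev.T ℝ (m:ℤ) := by
      apply Polynomial.funext; intro w; simp only [eval_comp, eval_mul, eval_C, eval_neg, eval_X]; exact e1 w
    have := congrArg (fun r => eval v (derivative r)) this
    simp only [derivative_comp, derivative_C_mul, eval_mul, eval_comp, eval_C, eval_neg, eval_X, derivative_neg, derivative_X, eval_one] at this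
    linarith
  rw [e2] at h2 h3
  rw [e1] at h1 h3
  refine ⟨(-1) ^ m, neg_one_pow_eq_or ℝ m, ?_, h1, by linarith, by linarith⟩
  rw [e1]; simp

noncomputable def rkU (a b : ℝ) : ℝ[X] :=
  C (2 / (b ^ 2 - a ^ 2)) * X ^ 2 - C ((a ^ 2 + b ^ 2) / (b ^ 2 - a ^ 2))

noncomputable def rkS (a b : ℝ) (m : ℕ) : ℝ[X] := (Chebyshev.T ℝ (m:ℤ)).comp (rkU a b)

noncomputable def rkW (a b : ℝ) (m : ℕ) : ℝ[X] :=
  (1 - rkU a b ^ 2) * (derivative (Chebyshev.T ℝ (m:ℤ))).comp (rkU a b)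

lemma rkU_eval (a b x : ℝ) : (rkU a b).eval x = (2 * x ^ 2 - a ^ 2 - b ^ 2) / (b ^ 2 - a ^ 2) := by
  simp [rkU]; ring

lemma rkU_deriv (a b x : ℝ) : (derivative (rkU a b)).eval x = 4 * x / (b ^ 2 - a ^ 2) := by
  simp [rkU]; ring

lemma rkU_deg (a b : ℝ) : (rkU a b).natDegree ≤ 2 := by
  unfold rkU; compute_degree

lemma rkW_deriv (a b : ℝ) (m : ℕ) (x v : ℝ) (hv : (rkU a b).eval x = v) :
    (derivative (rkW a b m)).eval x = (-v * (derivative (Chebyshev.T ℝ (m:ℤ))).eval v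
      - m ^ 2 * (Chebyshev.T ℝ (m:ℤ)).eval v) * (4 * x / (b ^ 2 - a ^ 2)) := by
  have := rk_ode m v
  simp [rkW, derivative_comp, rkU_deriv, hv, derivative_pow]
  linear_combination (4 * x / (b ^ 2 - a ^ 2)) * this

lemma rkW_eval (a b : ℝ) (m : ℕ) (x v : ℝ) (hv : (rkU a b).eval x = v) :
    (rkW a b m).eval x = (1 - v ^ 2) * (derivative (Chebyshev.T ℝ (m:ℤ))).eval v := by
  simp [rkW, hv]

lemma rkS_eval (a b : ℝ) (m : ℕ) (x v : ℝ) (hv : (rkU a b).eval x = v) :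
    (rkS a b m).eval x = (Chebyshev.T ℝ (m:ℤ)).eval v := by
  simp [rkS, hv]

lemma rkS_deg (a b : ℝ) (m : ℕ) : (rkS a b m).natDegree ≤ 2 * m := by
  unfold rkS
  rw [natDegree_comp, Chebyshev.natDegree_T]
  have := rkU_deg a b
  simp; nlinarith

lemma rkW_deg (a b : ℝ) (m : ℕ) (hm : 1 ≤ m) : (rkW a b m).natDegree ≤ 2 * m + 2 := by
  have hU := rkU_deg a b
  have h1 : (1 - rkU a b ^ 2).natDegree ≤ 4 := by
    refine (natDegree_sub_le _ _).trans ?_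
    have : (rkU a b ^ 2).natDegree ≤ 2 * (rkU a b).natDegree := natDegree_pow_le
    simp; omega
  have h2 : ((derivative (Chebyshev.T ℝ (m:ℤ))).comp (rkU a b)).natDegree ≤ 2 * (m - 1) := by
    rw [natDegree_comp]
    have := natDegree_derivative_le (Chebyshev.T ℝ (m:ℤ))
    rw [Chebyshev.natDegree_T] at this
    rw [Int.natAbs_natCast] at this
    nlinarith
  have := natDegree_mul_le (p := 1 - rkU a b ^ 2) (q := (derivative (Chebyshev.T ℝ (m:ℤ))).comp (rkU a b))
  unfold rkW
  omega

lemma rk_node_sign (a b : ℝ) (hD : 0 < b ^ 2 - a ^ 2) (m : ℕ) (hm : 1 ≤ m) (y : ℝ) (hy : y ≠ 0)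
    (hW : (rkW a b m).eval y = 0) (hS : (rkS a b m).eval y ^ 2 = 1) :
    (rkS a b m).eval y * (derivative (rkW a b m)).eval y * y < 0 := by
  have hm' : (1:ℝ) ≤ m := by exact_mod_cast hm
  rw [rkW_eval a b m y _ rfl] at hW
  rw [rkS_eval a b m y _ rfl] at hS ⊢
  rw [rkW_deriv a b m y _ rfl]
  set v := (rkU a b).eval y
  have ho := rk_ode m v
  set t := (Chebyshev.T ℝ (m:ℤ)).eval v
  set t' := (derivative (Chebyshev.T ℝ (m:ℤ))).eval v
  have hy2 : 0 < y ^ 2 := by positivity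
  have key : t * (-v * t' - m ^ 2 * t) < 0 := by
    rcases mul_eq_zero.mp hW with h | h
    · rw [h] at ho
      have : t * (-v * t' - m ^ 2 * t) = -2 * m ^ 2 * t ^ 2 := by linear_combination t * ho
      rw [this, hS]; nlinarith
    · rw [h]
      have : t * (-v * 0 - m ^ 2 * t) = - m ^ 2 * t ^ 2 := by ring
      rw [this, hS]; nlinarith
  have : t * ((-v * t' - m ^ 2 * t) * (4 * y / (b ^ 2 - a ^ 2))) * y =
    (t * (-v * t' - m ^ 2 * t)) * (4 * y ^ 2 / (b ^ 2 - a ^ 2)) := by ring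
  rw [this]
  exact mul_neg_of_neg_of_pos key (by positivity)

lemma rk_nodes (a b : ℝ) (ha : 0 < a) (hab : a < b) (m : ℕ) (hm : 1 ≤ m) :
    ∃ s : Finset ℝ, s.card = 2 * m + 2 ∧ a ∈ s ∧ -a ∈ s ∧ -b ∈ s ∧
      ∀ y ∈ s, (rkW a b m).eval y = 0 ∧ (rkS a b m).eval y ^ 2 = 1 ∧ a ≤ |y| ∧ |y| ≤ b := by
  classical
  have hD : 0 < b ^ 2 - a ^ 2 := by nlinarith
  have hm' : (1:ℝ) ≤ m := by exact_mod_cast hm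
  let Y : ℕ → ℝ := fun k => √((a ^ 2 + b ^ 2) / 2 + (b ^ 2 - a ^ 2) / 2 * Chebyshev.node m k)
  have hn : ∀ k, -1 ≤ Chebyshev.node m k ∧ Chebyshev.node m k ≤ 1 := fun k => Chebyshev.node_mem_Icc
  have hge : ∀ k, a ^ 2 ≤ (a ^ 2 + b ^ 2) / 2 + (b ^ 2 - a ^ 2) / 2 * Chebyshev.node m k := by
    intro k; nlinarith [hn k]
  have hle : ∀ k, (a ^ 2 + b ^ 2) / 2 + (b ^ 2 - a ^ 2) / 2 * Chebyshev.node m k ≤ b ^ 2 := by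
    intro k; nlinarith [hn k]
  have hYsq : ∀ k, Y k ^ 2 = (a ^ 2 + b ^ 2) / 2 + (b ^ 2 - a ^ 2) / 2 * Chebyshev.node m k := by
    intro k; exact Real.sq_sqrt (by nlinarith [hge k])
  have hYa : ∀ k, a ≤ Y k := fun k => Real.le_sqrt_of_sq_le (hge k)
  have hYb : ∀ k, Y k ≤ b := fun k => Real.sqrt_le_iff.mpr ⟨by linarith, hle k⟩
  have hUe : ∀ y k, y ^ 2 = Y k ^ 2 → (rkU a b).eval y = Chebyshev.node m k := by
    intro y k h
    rw [rkU_eval, h, hYsq]; field_simp; ring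
  have hinj : Set.InjOn Y (Finset.range (m + 1)) := by
    intro i hi j hj hij
    apply (Chebyshev.strictAntiOn_node m).injOn hi hj
    have h := hYsq i
    rw [hij, hYsq j] at h
    have h2 : (b ^ 2 - a ^ 2) / 2 * Chebyshev.node m j = (b ^ 2 - a ^ 2) / 2 * Chebyshev.node m i := by linarith
    exact (mul_left_cancel₀ (by positivity) h2).symm
  have hprop : ∀ y k, k ∈ Finset.range (m+1) → y ^ 2 = Y k ^ 2 → (rkW a b m).eval y = 0 ∧ (rkS a b m).eval y ^ 2 = 1 := by
    intro y k hk h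
    have hu := hUe y k h
    have hT : (Chebyshev.T ℝ (m:ℤ)).eval (Chebyshev.node m k) = (-1) ^ k :=
      Chebyshev.eval_T_real_node (by simp at hk ⊢; omega)
    constructor
    · rw [rkW_eval a b m y _ hu]
      have h1 := rk_T_cos m (k * Real.pi / m)
      have h2 := rk_dT_cos m (k * Real.pi / m)
      have hs : Real.sin (m * (k * Real.pi / m)) = 0 := by
        rw [mul_div_cancel₀ _ (by positivity)]; exact Real.sin_nat_mul_pi k
      have : 1 - Chebyshev.node m k ^ 2 = Real.sin (k * Real.pi / m) ^ 2 := by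
        rw [Chebyshev.node, Real.sin_sq]
      rw [this]
      unfold Chebyshev.node
      rw [hs] at h2
      linear_combination Real.sin (k * Real.pi / m) * h2
    · rw [rkS_eval a b m y _ hu, hT, ← pow_mul, mul_comm, pow_mul]; simp
  have hY0 : Y 0 = b := by
    have : (a ^ 2 + b ^ 2) / 2 + (b ^ 2 - a ^ 2) / 2 * 1 = b ^ 2 := by ring
    simp only [Y, Chebyshev.node_eq_one, this]
    exact Real.sqrt_sq (by linarith)
  have hYm : Y m = a := by
    have : (a ^ 2 + b ^ 2) / 2 + (b ^ 2 - a ^ 2) / 2 * (-1) = a ^ 2 := by ring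
    simp only [Y, Chebyshev.node_eq_neg_one (by omega : m ≠ 0), this]
    exact Real.sqrt_sq (by linarith)
  refine ⟨(Finset.range (m + 1)).image Y ∪ (Finset.range (m + 1)).image (fun k => - Y k), ?_, ?_, ?_, ?_, ?_⟩
  · rw [Finset.card_union_of_disjoint, Finset.card_image_of_injOn hinj, Finset.card_image_of_injOn]
    · simp; ring
    · intro i hi j hj hij; exact hinj hi hj (neg_injective hij)
    · rw [Finset.disjoint_left]
      intro y hy hy'
      simp only [Finset.mem_image] at hy hy'
      obtain ⟨i, _, rfl⟩ := hy
      obtain ⟨j, _, hj⟩ := hy'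
      linarith [hYa i, hYa j]
  · exact Finset.mem_union_left _ (Finset.mem_image.mpr ⟨m, by simp, hYm⟩)
  · exact Finset.mem_union_right _ (Finset.mem_image.mpr ⟨m, by simp, by rw [hYm]⟩)
  · exact Finset.mem_union_right _ (Finset.mem_image.mpr ⟨0, by simp, by rw [hY0]⟩)
  · intro y hy
    have : ∃ k ∈ Finset.range (m+1), |y| = Y k := by
      rcases Finset.mem_union.mp hy with h | h
      · obtain ⟨k, hk, rfl⟩ := Finset.mem_image.mp h
        exact ⟨k, hk, abs_of_nonneg (by linarith [hYa k])⟩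
      · obtain ⟨k, hk, rfl⟩ := Finset.mem_image.mp h
        exact ⟨k, hk, by rw [abs_neg]; exact abs_of_nonneg (by linarith [hYa k])⟩
    obtain ⟨k, hk, h⟩ := this
    obtain ⟨h1, h2⟩ := hprop y k hk (by rw [← h, sq_abs])
    exact ⟨h1, h2, h ▸ hYa k, h ▸ hYb k⟩

lemma rk_bound (s : Finset ℝ) (P S K : ℝ → ℝ) (σ : ℝ) (hσ : |σ| = 1)
    (hP : ∀ y ∈ s, |P y| ≤ 1) (hS : ∀ y ∈ s, S y ^ 2 = 1)
    (hpos : ∀ y ∈ s, 0 ≤ σ * (S y * K y)) :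
    |∑ y ∈ s, P y * K y| ≤ |∑ y ∈ s, S y * K y| := by
  calc |∑ y ∈ s, P y * K y| ≤ ∑ y ∈ s, |P y * K y| := Finset.abs_sum_le_sum_abs _ _
    _ ≤ ∑ y ∈ s, σ * (S y * K y) := by
        apply Finset.sum_le_sum
        intro y hy
        rw [← abs_of_nonneg (hpos y hy), abs_mul, abs_mul σ, hσ, one_mul, abs_mul]
        have : |S y| = 1 := by
          have h := hS y hy
          rcases mul_self_eq_one_iff.mp ((sq (S y)).symm.trans h) with h | h <;> rw [h] <;> simp
        rw [this]
        exact mul_le_mul_of_nonneg_right (hP y hy) (abs_nonneg _)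
    _ = σ * ∑ y ∈ s, S y * K y := by rw [Finset.mul_sum]
    _ ≤ |σ * ∑ y ∈ s, S y * K y| := le_abs_self _
    _ = _ := by rw [abs_mul, hσ, one_mul]

/-- the logarithmic derivative of `rkW` -/
lemma rk_R (a b : ℝ) (m : ℕ) (x v t t' : ℝ) (hP : 0 < x ^ 2 - a ^ 2) (hQ : 0 < b ^ 2 - x ^ 2)
    (hv : (rkU a b).eval x = v)
    (ht : (Chebyshev.T ℝ (m:ℤ)).eval v = t) (ht' : (derivative (Chebyshev.T ℝ (m:ℤ))).eval v = t')
    (h0 : t' ≠ 0) :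
    (derivative (rkW a b m)).eval x / (rkW a b m).eval x =
      x * (b ^ 2 - a ^ 2) * (-v - m ^ 2 * t / t') / ((x ^ 2 - a ^ 2) * (b ^ 2 - x ^ 2)) := by
  rw [rkW_deriv a b m x v hv, rkW_eval a b m x v hv, ht, ht']
  have hD : 0 < b ^ 2 - a ^ 2 := by linarith
  have hv1 : 1 - v ^ 2 = 4 * (x ^ 2 - a ^ 2) * (b ^ 2 - x ^ 2) / (b ^ 2 - a ^ 2) ^ 2 := by
    rw [← hv, rkU_eval]; field_simp; ring
  rw [hv1]
  field_simp

lemma rk_W_pos (a b : ℝ) (x v : ℝ) (hP : 0 < x ^ 2 - a ^ 2) (hQ : 0 < b ^ 2 - x ^ 2)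
    (hv : (rkU a b).eval x = v) : 0 < 1 - v ^ 2 := by
  have hD : 0 < b ^ 2 - a ^ 2 := by linarith
  have hv1 : 1 - v ^ 2 = 4 * (x ^ 2 - a ^ 2) * (b ^ 2 - x ^ 2) / (b ^ 2 - a ^ 2) ^ 2 := by
    rw [← hv, rkU_eval]; field_simp; ring
  rw [hv1]; positivity

lemma rk_lt_one (v : ℝ) (h : 0 < 1 - v ^ 2) : -1 < v ∧ v < 1 :=
  abs_lt.mp ((sq_lt_one_iff_abs_lt_one v).mp (by linarith))

lemma rk_U_mul (a b x v : ℝ) (hD : 0 < b ^ 2 - a ^ 2) (hv : (rkU a b).eval x = v) :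
    (b ^ 2 - a ^ 2) * v = (x ^ 2 - a ^ 2) - (b ^ 2 - x ^ 2) := by
  rw [← hv, rkU_eval]; field_simp; ring

set_option maxHeartbeats 2000000 in
lemma rk_caseB (a b : ℝ) (ha : 0 < a) (hab : a < b) (m : ℕ) (hm : 1 ≤ m) (p : ℝ[X])
    (hdeg : p.natDegree ≤ 2 * m) (hp : ∀ y, a ≤ |y| → |y| ≤ b → |p.eval y| ≤ 1)
    (x : ℝ) (hxa : a < x) (hxb : x < b) (hx : Real.cos (Real.pi / (2 * m)) ≤ (rkU a b).eval x) :
    |(derivative p).eval x| ≤ |(derivative (rkS a b m)).eval x| := by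
  have hP : 0 < x ^ 2 - a ^ 2 := by nlinarith
  have hQ : 0 < b ^ 2 - x ^ 2 := by nlinarith
  have hD : 0 < b ^ 2 - a ^ 2 := by linarith
  obtain ⟨s, hcard, has, -, -, hs⟩ := rk_nodes a b ha hab m hm
  set v := (rkU a b).eval x with hv
  have hv2 := rk_W_pos a b x v hP hQ rfl
  obtain ⟨ht, ht', htt⟩ := rk_cheb m hm v hx (rk_lt_one _ hv2).2
  have hWx : 0 < (rkW a b m).eval x := by
    rw [rkW_eval a b m x v rfl]; positivity
  have hR := rk_R a b m x v _ _ hP hQ rfl rfl rfl ht'.ne'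
  have hI := fun q hq => rk_interp s (rkW a b m) q (by rw [hcard]; exact rkW_deg a b m hm)
    (fun y hy => (hs y hy).1) a has hq x hWx.ne'
  rw [hI p (by omega), hI (rkS a b m) (by have := rkS_deg a b m; omega)]
  set R := (derivative (rkW a b m)).eval x / (rkW a b m).eval x
  have hDv := rk_U_mul a b x v hD rfl
  have hq0 : 0 ≤ m ^ 2 * (Chebyshev.T ℝ (m:ℤ)).eval v / (derivative (Chebyshev.T ℝ (m:ℤ))).eval v := by positivity
  have hq1 : m ^ 2 * (Chebyshev.T ℝ (m:ℤ)).eval v / (derivative (Chebyshev.T ℝ (m:ℤ))).eval v ≤ v := by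
    rwa [div_le_iff₀ ht']
  set q := m ^ 2 * (Chebyshev.T ℝ (m:ℤ)).eval v / (derivative (Chebyshev.T ℝ (m:ℤ))).eval v
  have hx0 : 0 < x := by linarith
  have hxD : 0 < x * (b ^ 2 - a ^ 2) := by positivity
  have hR1 : R ≤ x / (x ^ 2 - a ^ 2) - x / (b ^ 2 - x ^ 2) := by
    rw [hR, div_sub_div _ _ hP.ne' hQ.ne', div_le_div_iff_of_pos_right (by positivity)]
    nlinarith
  have hR2 : 2 * (x / (x ^ 2 - a ^ 2) - x / (b ^ 2 - x ^ 2)) ≤ R := by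
    rw [hR, div_sub_div _ _ hP.ne' hQ.ne', ← mul_div_assoc, div_le_div_iff_of_pos_right (by positivity)]
    nlinarith
  have e1 : 2 * (x / (x ^ 2 - a ^ 2)) = 1 / (x - a) + 1 / (x + a) := by
    have : x - a ≠ 0 := by linarith
    have : x + a ≠ 0 := by linarith
    have : x ^ 2 - a ^ 2 ≠ 0 := hP.ne'
    rw [show x ^ 2 - a ^ 2 = (x - a) * (x + a) by ring]
    field_simp; ring
  have e2 : 2 * (x / (b ^ 2 - x ^ 2)) = 1 / (b - x) - 1 / (b + x) := by
    have : b - x ≠ 0 := by linarith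
    have : b + x ≠ 0 := by linarith
    rw [show b ^ 2 - x ^ 2 = (b - x) * (b + x) by ring]
    field_simp; ring
  have p1 : 0 < 1 / (x - a) := one_div_pos.mpr (by linarith)
  have p2 : 0 < 1 / (x + a) := one_div_pos.mpr (by linarith)
  have p3 : 0 < 1 / (b - x) := one_div_pos.mpr (by linarith)
  have p4 : 0 < 1 / (b + x) := one_div_pos.mpr (by linarith)
  have p5 : 1 / (x + a) ≤ 1 / (x - a) := one_div_le_one_div_of_le (by linarith) (by linarith)
  apply rk_bound _ _ _ _ 1 (by simp)
  · intro y hy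
    have := hs y (Finset.mem_of_mem_erase hy)
    exact hp y this.2.2.1 this.2.2.2
  · intro y hy
    exact (hs y (Finset.mem_of_mem_erase hy)).2.1
  intro y hy
  have hya := Finset.ne_of_mem_erase hy
  obtain ⟨hWy, hSy, hy1, hy2⟩ := hs y (Finset.mem_of_mem_erase hy)
  have hy0 : y ≠ 0 := by rintro rfl; simp at hy1; linarith
  have hsg := rk_node_sign a b hD m hm y hy0 hWy hSy
  set Sy := (rkS a b m).eval y
  set W' := (derivative (rkW a b m)).eval y
  have hW'0 : W' ≠ 0 := by intro h; rw [h] at hsg; simp at hsg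
  have hyy : 0 < y * (y - a) := by
    rcases lt_or_gt_of_ne hy0 with h | h
    · nlinarith
    · rw [abs_of_pos h] at hy1
      exact mul_pos h (by linarith [lt_of_le_of_ne hy1 (Ne.symm hya)])
  have hA : Sy * (y - a) / W' ≤ 0 := by
    have h1 : Sy * W' * (y - a) < 0 := by
      by_contra h
      push Not at h
      have h2 := mul_neg_of_neg_of_pos hsg hyy
      have h3 : Sy * W' * y * (y * (y - a)) = (Sy * W' * (y - a)) * y ^ 2 := by ring
      rw [h3] at h2
      have := mul_nonneg h (sq_nonneg y)
      linarith
    have : Sy * (y - a) / W' = Sy * W' * (y - a) / W' ^ 2 := by field_simp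
    rw [this]
    exact div_nonpos_of_nonpos_of_nonneg h1.le (sq_nonneg _)
  have hB : (R - 1 / (x - a) - 1 / (x - y)) / (x - y) ≤ 0 := by
    by_cases hyb : y = b
    · subst hyb
      apply div_nonpos_of_nonneg_of_nonpos _ (by linarith)
      have : 1 / (x - y) = - (1 / (y - x)) := by rw [← neg_sub y x, one_div, one_div, inv_neg]
      linarith
    · have hyx : y < x := by
        by_contra h
        push Not at h
        have hy3 : 0 < y := by linarith
        rw [abs_of_pos hy3] at hy2
        have hyb' : y < b := lt_of_le_of_ne hy2 hyb
        have hle : v ≤ (rkU a b).eval y := by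
          rw [hv, rkU_eval, rkU_eval, div_le_div_iff_of_pos_right hD]
          nlinarith
        have hv3 := rk_W_pos a b y _ (by nlinarith) (by nlinarith) rfl
        have := (rk_cheb m hm ((rkU a b).eval y) (hx.trans hle) (rk_lt_one _ hv3).2).2.1
        rw [rkW_eval a b m y _ rfl] at hWy
        have := mul_pos hv3 this
        linarith
      apply div_nonpos_of_nonpos_of_nonneg _ (by linarith)
      have : 1 / (b + x) ≤ 1 / (x - y) := 
        one_div_le_one_div_of_le (by linarith) (by linarith [neg_abs_le y])
      linarith
  have : Sy * ((y - a) / W' * (eval x (rkW a b m) / ((x - a) * (x - y)) * (R - 1 / (x - a) - 1 / (x - y))))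
    = (eval x (rkW a b m) / (x - a)) * ((Sy * (y - a) / W') * ((R - 1 / (x - a) - 1 / (x - y)) / (x - y))) := by
    rw [← div_div]; ring
  rw [one_mul, this]
  exact mul_nonneg (div_nonneg hWx.le (by linarith)) (mul_nonneg_of_nonpos_of_nonpos hA hB)

lemma rk_ineq (a b x : ℝ) (ha : 0 < a) (hxa : a < x) (hxb : x < b)
    (h : 17 * (x ^ 2 - a ^ 2) ≤ 3 * (b ^ 2 - x ^ 2)) :
    1 / (2 * x) + 1 / (x + b) ≤ x / (x ^ 2 - a ^ 2) - x / (b ^ 2 - x ^ 2) := by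
  have hx0 : 0 < x := by linarith
  have hP : 0 < x ^ 2 - a ^ 2 := by nlinarith
  have hQ : 0 < b ^ 2 - x ^ 2 := by nlinarith
  have hb : 1 / (x + b) = (b - x) / (b ^ 2 - x ^ 2) := by
    have : x + b ≠ 0 := by linarith
    field_simp; ring
  have key : 2 * b * x * (x ^ 2 - a ^ 2) ≤ 2 * a ^ 2 * (b ^ 2 - x ^ 2) + (x ^ 2 - a ^ 2) * (b ^ 2 - x ^ 2) := by
    obtain ⟨P, hPe⟩ : ∃ P, P = x ^ 2 - a ^ 2 := ⟨_, rfl⟩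
    obtain ⟨Q, hQe⟩ : ∃ Q, Q = b ^ 2 - x ^ 2 := ⟨_, rfl⟩
    rw [← hPe, ← hQe]
    rw [← hPe] at hP h
    rw [← hQe] at hQ h
    have h1 : 2 * b * x ≤ 2.9 * a ^ 2 + 2.9 * P + 0.4 * Q := by
      have : (0:ℝ) ≤ (0.4 * b - x) ^ 2 := sq_nonneg _
      nlinarith
    have h2 : 2 * b * x * P ≤ (2.9 * a ^ 2 + 2.9 * P + 0.4 * Q) * P := by gcongr
    have h3 : a ^ 2 * (17 * P) ≤ a ^ 2 * (3 * Q) := by gcongr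
    have h4 : P * (17 * P) ≤ P * (3 * Q) := by gcongr
    have h5 : 0 < P * Q := by positivity
    have h6 : 0 < a ^ 2 * Q := by positivity
    nlinarith
  have : x / (x ^ 2 - a ^ 2) - x / (b ^ 2 - x ^ 2) - (1 / (2 * x) + (b - x) / (b ^ 2 - x ^ 2)) =
    (2 * a ^ 2 * (b ^ 2 - x ^ 2) + (x ^ 2 - a ^ 2) * (b ^ 2 - x ^ 2) - 2 * b * x * (x ^ 2 - a ^ 2)) /
      (2 * x * (x ^ 2 - a ^ 2) * (b ^ 2 - x ^ 2)) := by
    have := hP.ne'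
    have := hQ.ne'
    field_simp; ring
  have h2 : 0 ≤ (2 * a ^ 2 * (b ^ 2 - x ^ 2) + (x ^ 2 - a ^ 2) * (b ^ 2 - x ^ 2) - 2 * b * x * (x ^ 2 - a ^ 2)) /
      (2 * x * (x ^ 2 - a ^ 2) * (b ^ 2 - x ^ 2)) := div_nonneg (by linarith) (by positivity)
  rw [hb]
  linarith

lemma rk_cos_ge (m : ℕ) (hm : 2 ≤ m) : 0.7 ≤ Real.cos (Real.pi / (2 * m)) := by
  have hm' : (2:ℝ) ≤ m := by exact_mod_cast hm
  have h : Real.cos (Real.pi / 4) ≤ Real.cos (Real.pi / (2 * m)) := by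
    have hpi := Real.pi_pos
    apply Real.cos_le_cos_of_nonneg_of_le_pi (by positivity) (by linarith)
    gcongr; linarith
  rw [Real.cos_pi_div_four] at h
  have : (1.4:ℝ) ≤ √2 := Real.le_sqrt_of_sq_le (by norm_num)
  linarith

set_option maxHeartbeats 4000000 in
lemma rk_caseA (a b : ℝ) (ha : 0 < a) (hab : a < b) (m : ℕ) (hm : 1 ≤ m) (p : ℝ[X])
    (hdeg : p.natDegree ≤ 2 * m) (hp : ∀ y, a ≤ |y| → |y| ≤ b → |p.eval y| ≤ 1)
    (hpa : p.eval (-a) = p.eval a)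
    (x : ℝ) (hxa : a < x) (hxb : x < b) (hx : (rkU a b).eval x ≤ -Real.cos (Real.pi / (2 * m))) :
    |(derivative p).eval x| ≤ |(derivative (rkS a b m)).eval x| := by
  classical
  have hP : 0 < x ^ 2 - a ^ 2 := by nlinarith
  have hQ : 0 < b ^ 2 - x ^ 2 := by nlinarith
  have hD : 0 < b ^ 2 - a ^ 2 := by linarith
  have hx0 : 0 < x := by linarith
  obtain ⟨s, hcard, has, has', hbs, hs⟩ := rk_nodes a b ha hab m hm
  set v := (rkU a b).eval x with hv
  have hv2 := rk_W_pos a b x v hP hQ rfl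
  obtain ⟨ε, hε, hTε, ht, ht', htt⟩ := rk_cheb_neg m hm v hx (rk_lt_one _ hv2).1
  have hεε : ε * ε = 1 := by rcases hε with h | h <;> rw [h] <;> norm_num
  have hWx : ε * (rkW a b m).eval x < 0 := by
    rw [rkW_eval a b m x v rfl]
    have : ε * ((1 - v ^ 2) * eval v (derivative (Chebyshev.T ℝ (m:ℤ)))) =
      (1 - v ^ 2) * (ε * eval v (derivative (Chebyshev.T ℝ (m:ℤ)))) := by ring
    rw [this]
    exact mul_neg_of_pos_of_neg hv2 ht'
  have hWx0 : (rkW a b m).eval x ≠ 0 := by intro h; rw [h] at hWx; simp at hWx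
  have ht'0 : eval v (derivative (Chebyshev.T ℝ (m:ℤ))) ≠ 0 := by intro h; rw [h] at ht'; simp at ht'
  have hR := rk_R a b m x v _ _ hP hQ rfl rfl rfl ht'0
  have hI := fun q hq => rk_interp s (rkW a b m) q (by rw [hcard]; exact rkW_deg a b m hm)
    (fun y hy => (hs y hy).1) (-b) hbs hq x hWx0
  set R := (derivative (rkW a b m)).eval x / (rkW a b m).eval x
  have hDv := rk_U_mul a b x v hD rfl
  have hε0 : ε ≠ 0 := by intro h; rw [h] at hεε; simp at hεε
  have hqe : m ^ 2 * (Chebyshev.T ℝ (m:ℤ)).eval v / (derivative (Chebyshev.T ℝ (m:ℤ))).eval v =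
     m ^ 2 * (ε * (Chebyshev.T ℝ (m:ℤ)).eval v) / (ε * (derivative (Chebyshev.T ℝ (m:ℤ))).eval v) := by
    field_simp
  have hq0 : m ^ 2 * (Chebyshev.T ℝ (m:ℤ)).eval v / (derivative (Chebyshev.T ℝ (m:ℤ))).eval v ≤ 0 := by
    rw [hqe]
    exact div_nonpos_of_nonneg_of_nonpos (by positivity) ht'.le
  have hq1 : v ≤ m ^ 2 * (Chebyshev.T ℝ (m:ℤ)).eval v / (derivative (Chebyshev.T ℝ (m:ℤ))).eval v := by
    rw [hqe, le_div_iff_of_neg ht']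
    linarith
  set q := m ^ 2 * (Chebyshev.T ℝ (m:ℤ)).eval v / (derivative (Chebyshev.T ℝ (m:ℤ))).eval v
  have hxD : 0 < x * (b ^ 2 - a ^ 2) := by positivity
  have hR1 : x / (x ^ 2 - a ^ 2) - x / (b ^ 2 - x ^ 2) ≤ R := by
    rw [hR, div_sub_div _ _ hP.ne' hQ.ne', div_le_div_iff_of_pos_right (by positivity)]
    nlinarith
  have hR2 : R ≤ 2 * (x / (x ^ 2 - a ^ 2) - x / (b ^ 2 - x ^ 2)) := by
    rw [hR, div_sub_div _ _ hP.ne' hQ.ne', ← mul_div_assoc, div_le_div_iff_of_pos_right (by positivity)]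
    nlinarith
  have hv0 : v ≤ 0 := hq1.trans hq0
  have hR0 : 0 ≤ R := by
    rw [hR]
    apply div_nonneg _ (by positivity)
    exact mul_nonneg hxD.le (by linarith)
  have p2 : 0 < x / (b ^ 2 - x ^ 2) := by positivity
  have hR3 : R - 2 * x / (x ^ 2 - a ^ 2) ≤ 0 := by
    rw [mul_div_assoc]; linarith
  set K : ℝ → ℝ := fun y => ((y - -b) / (derivative (rkW a b m)).eval y *
      ((rkW a b m).eval x / ((x - -b) * (x - y)) * (R - 1 / (x - -b) - 1 / (x - y)))) with hK
  set K' : ℝ → ℝ := fun y => K y + if y = a then K (-a) else 0 with hK'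
  have haa' : a ≠ -a := by intro h; linarith
  have hma : -a ∈ s.erase (-b) := Finset.mem_erase.mpr ⟨by intro h; linarith, has'⟩
  have haE : a ∈ (s.erase (-b)).erase (-a) :=
    Finset.mem_erase.mpr ⟨haa', Finset.mem_erase.mpr ⟨by intro h; linarith, has⟩⟩
  have hsum : ∀ r : ℝ[X], r.natDegree + 2 ≤ s.card → r.eval (-a) = r.eval a →
      (derivative r).eval x = ∑ y ∈ (s.erase (-b)).erase (-a), r.eval y * K' y := by
    intro r hr hra
    have h1 : (derivative r).eval x = ∑ y ∈ s.erase (-b), r.eval y * K y := hI r hr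
    rw [h1, ← Finset.add_sum_erase _ _ hma]
    simp only [hK', mul_add, Finset.sum_add_distrib, mul_ite, mul_zero]
    rw [Finset.sum_ite_eq' ((s.erase (-b)).erase (-a)) a, if_pos haE, hra]
    ring
  have hUa : ∀ y, (rkU a b).eval (-y) = (rkU a b).eval y := by
    intro y; rw [rkU_eval, rkU_eval]; ring
  have hSa : (rkS a b m).eval (-a) = (rkS a b m).eval a := by
    rw [rkS_eval a b m _ _ (hUa a), rkS_eval a b m _ _ rfl]
  rw [hsum p (by omega) hpa, hsum (rkS a b m) (by have := rkS_deg a b m; omega) hSa]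
  apply rk_bound _ _ _ _ (-ε) (by rcases hε with h | h <;> rw [h] <;> simp)
  · intro y hy
    have := hs y (Finset.mem_of_mem_erase (Finset.mem_of_mem_erase hy))
    exact hp y this.2.2.1 this.2.2.2
  · intro y hy
    exact (hs y (Finset.mem_of_mem_erase (Finset.mem_of_mem_erase hy))).2.1
  intro y hy
  have hya := Finset.ne_of_mem_erase hy
  have hyb := Finset.ne_of_mem_erase (Finset.mem_of_mem_erase hy)
  obtain ⟨hWy, hSy, hy1, hy2⟩ := hs y (Finset.mem_of_mem_erase (Finset.mem_of_mem_erase hy))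
  have hy0 : y ≠ 0 := by rintro rfl; simp at hy1; linarith
  have hsg := rk_node_sign a b hD m hm y hy0 hWy hSy
  have hW'0 : (derivative (rkW a b m)).eval y ≠ 0 := by intro h; rw [h] at hsg; simp at hsg
  by_cases hyeq : y = a
  · subst hyeq
    have hUy : (rkU y b).eval y = -1 := by
      rw [rkU_eval]; field_simp; ring
    rw [rkS_eval y b m y _ hUy, hTε] at hsg ⊢
    have hW'n : (derivative (rkW y b m)).eval (-y) = -(derivative (rkW y b m)).eval y := by
      rw [rkW_deriv y b m y _ rfl, rkW_deriv y b m (-y) _ (hUa y)]; ring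
    have hεW : ε * (derivative (rkW y b m)).eval y < 0 := by
      by_contra h
      push Not at h
      have := mul_nonneg h ha.le
      linarith
    have hKs : K' y = (ε * (rkW y b m).eval x) / (ε * (derivative (rkW y b m)).eval y) *
        (2 * y / (x ^ 2 - y ^ 2)) * (R - 2 * x / (x ^ 2 - y ^ 2)) := by
      simp only [hK', if_pos, hK, hW'n]
      have n1 : x - y ≠ 0 := by linarith
      have n2 : x + y ≠ 0 := by linarith
      have n3 : x + b ≠ 0 := by linarith
      rw [show x ^ 2 - y ^ 2 = (x - y) * (x + y) by ring]
      simp only [sub_neg_eq_add]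
      clear_value R
      field_simp
      ring
    have h1 : 0 < (ε * (rkW y b m).eval x) / (ε * (derivative (rkW y b m)).eval y) :=
      div_pos_of_neg_of_neg hWx hεW
    have h2 : K' y ≤ 0 := by
      rw [hKs]
      exact mul_nonpos_of_nonneg_of_nonpos (by positivity) hR3
    have : -ε * (ε * K' y) = -(ε * ε) * K' y := by ring
    rw [this, hεε]; linarith
  have hK'y : K' y = K y := by simp only [hK', if_neg hyeq, add_zero]
  rw [hK'y]
  have hya2 : a < |y| := by
    apply lt_of_le_of_ne hy1
    intro h
    rcases abs_choice y with h2 | h2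
    · rw [h2] at h; exact hyeq h.symm
    · rw [h2] at h; exact hya (by linarith)
  have hyx : x < |y| := by
    by_contra h
    push Not at h
    have hUabs : (rkU a b).eval |y| = (rkU a b).eval y := by rw [rkU_eval, rkU_eval, sq_abs]
    have hle : (rkU a b).eval y ≤ v := by
      rw [hv, ← hUabs, rkU_eval, rkU_eval, div_le_div_iff_of_pos_right hD]
      nlinarith
    have hv3 := rk_W_pos a b |y| _ (by nlinarith) (by nlinarith) hUabs
    obtain ⟨ε', -, -, -, h4, -⟩ := rk_cheb_neg m hm ((rkU a b).eval y) (hle.trans hx) (rk_lt_one _ hv3).1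
    rw [rkW_eval a b m y _ rfl] at hWy
    rcases mul_eq_zero.mp hWy with h5 | h5
    · linarith
    · rw [h5] at h4; simp at h4
  have hyb2 : 0 < y + b := by
    have h1 := neg_abs_le y
    have : -b ≤ y := by linarith
    have := lt_of_le_of_ne this (Ne.symm hyb)
    linarith
  set Sy := (rkS a b m).eval y
  set W' := (derivative (rkW a b m)).eval y
  have hA : Sy * (y + b) / W' * y ≤ 0 := by
    have : Sy * (y + b) / W' * y = (Sy * W' * y) * (y + b) / W' ^ 2 := by field_simp
    rw [this]
    exact div_nonpos_of_nonpos_of_nonneg (mul_nonpos_of_nonpos_of_nonneg hsg.le hyb2.le) (sq_nonneg _)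
  have hB0 : 0 ≤ R - 1 / (x + b) - 1 / (x - y) := by
    rcases lt_or_gt_of_ne hy0 with h | h
    · rw [abs_of_neg h] at hyx hya2 hy2
      have hm2 : 2 ≤ m := by
        by_contra hlt
        have hm1 : m = 1 := by omega
        subst hm1
        rw [rkW_eval a b 1 y _ rfl, rkU_eval] at hWy
        simp at hWy
        have e : 1 - ((2 * y ^ 2 - a ^ 2 - b ^ 2) / (b ^ 2 - a ^ 2)) ^ 2 =
          4 * (y ^ 2 - a ^ 2) * (b ^ 2 - y ^ 2) / (b ^ 2 - a ^ 2) ^ 2 := by field_simp; ring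
        rw [e] at hWy
        have h1 : 0 < y ^ 2 - a ^ 2 := by nlinarith
        have h2 : 0 < b ^ 2 - y ^ 2 := by nlinarith
        have : 0 < 4 * (y ^ 2 - a ^ 2) * (b ^ 2 - y ^ 2) / (b ^ 2 - a ^ 2) ^ 2 := by positivity
        linarith
      have hc := rk_cos_ge m hm2
      have hv7 : v ≤ -0.7 := by linarith
      have hi := rk_ineq a b x ha hxa hxb (by nlinarith)
      have : 1 / (x - y) ≤ 1 / (2 * x) := one_div_le_one_div_of_le (by linarith) (by linarith)
      linarith
    · rw [abs_of_pos h] at hyx hy2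
      have h1 : 1 / (x - y) = - (1 / (y - x)) := by rw [← neg_sub y x, one_div, one_div, inv_neg]
      have h2 : 1 / (x + b) ≤ 1 / (y - x) := one_div_le_one_div_of_le (by linarith) (by linarith)
      linarith
  have hB : (R - 1 / (x + b) - 1 / (x - y)) / (x - y) * y ≤ 0 := by
    have : (R - 1 / (x + b) - 1 / (x - y)) / (x - y) * y =
      (R - 1 / (x + b) - 1 / (x - y)) * (y / (x - y)) := by ring
    rw [this]
    apply mul_nonpos_of_nonneg_of_nonpos hB0
    rcases lt_or_gt_of_ne hy0 with h | h
    · exact div_nonpos_of_nonpos_of_nonneg h.le (by linarith)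
    · rw [abs_of_pos h] at hyx
      exact div_nonpos_of_nonneg_of_nonpos h.le (by linarith)
  have hAB : 0 ≤ (Sy * (y + b) / W') * ((R - 1 / (x + b) - 1 / (x - y)) / (x - y)) := by
    have h1 := mul_nonneg_of_nonpos_of_nonpos hA hB
    have h2 : 0 < y ^ 2 := by positivity
    refine nonneg_of_mul_nonneg_left (b := y ^ 2) ?_ h2
    linarith
  have : -ε * (Sy * K y) = (-(ε * eval x (rkW a b m)) / (x + b)) *
      ((Sy * (y + b) / W') * ((R - 1 / (x + b) - 1 / (x - y)) / (x - y))) := by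
    simp only [hK, sub_neg_eq_add]
    rw [← div_div]; ring
  rw [this]
  exact mul_nonneg (div_nonneg (by linarith) (by linarith)) hAB

/-- both cases, including the endpoints, for positive `x` -/
lemma rk_pos (a b : ℝ) (ha : 0 < a) (hab : a < b) (m : ℕ) (hm : 1 ≤ m) (p : ℝ[X])
    (hdeg : p.natDegree ≤ 2 * m) (hp : ∀ y, a ≤ |y| → |y| ≤ b → |p.eval y| ≤ 1)
    (hpa : p.eval (-a) = p.eval a)
    (x : ℝ) (hxa : a ≤ x) (hxb : x ≤ b) (hx : Real.cos (Real.pi / (2 * m)) ≤ |(rkU a b).eval x|) :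
    |(derivative p).eval x| ≤ |(derivative (rkS a b m)).eval x| := by
  have hD : 0 < b ^ 2 - a ^ 2 := by nlinarith
  have hm' : (1:ℝ) ≤ m := by exact_mod_cast hm
  have hpi := Real.pi_pos
  have hc : Real.cos (Real.pi / (2 * m)) < 1 := by
    rw [← Real.cos_zero]
    apply Real.cos_lt_cos_of_nonneg_of_le_pi le_rfl _ (by positivity)
    calc Real.pi / (2 * m) ≤ Real.pi / 1 := by gcongr; linarith
      _ = _ := by simp
  have hin : ∀ x, a < x → x < b → Real.cos (Real.pi / (2 * m)) ≤ |(rkU a b).eval x| →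
      |(derivative p).eval x| ≤ |(derivative (rkS a b m)).eval x| := by
    intro x h1 h2 h3
    rcases le_abs.mp h3 with h | h
    · exact rk_caseB a b ha hab m hm p hdeg hp x h1 h2 h
    · exact rk_caseA a b ha hab m hm p hdeg hp hpa x h1 h2 (by linarith)
  have hcl : IsClosed {x | |(derivative p).eval x| ≤ |(derivative (rkS a b m)).eval x|} :=
    isClosed_le (by fun_prop) (by fun_prop)
  have hop : IsOpen {x | Real.cos (Real.pi / (2 * m)) < |(rkU a b).eval x|} :=
    isOpen_lt (by fun_prop) (by fun_prop)
  have hend : ∀ x, x ∈ Icc a b → Real.cos (Real.pi / (2 * m)) < |(rkU a b).eval x| →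
      |(derivative p).eval x| ≤ |(derivative (rkS a b m)).eval x| := by
    intro x hx hx'
    have h1 : x ∈ closure (Ioo a b) := by rwa [closure_Ioo hab.ne]
    have h2 : x ∈ closure (Ioo a b ∩ {x | Real.cos (Real.pi / (2 * m)) < |(rkU a b).eval x|}) :=
      hop.closure_inter ⟨h1, hx'⟩
    have h3 : Ioo a b ∩ {x | Real.cos (Real.pi / (2 * m)) < |(rkU a b).eval x|} ⊆
        {x | |(derivative p).eval x| ≤ |(derivative (rkS a b m)).eval x|} :=
      fun z hz => hin z hz.1.1 hz.1.2 (le_of_lt hz.2)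
    exact hcl.closure_subset_iff.mpr h3 h2
  rcases hxa.eq_or_lt with h | h
  · subst h
    refine hend a ⟨le_rfl, hab.le⟩ ?_
    have : (rkU a b).eval a = -1 := by rw [rkU_eval]; field_simp; ring
    rw [this]; simpa using hc
  rcases hxb.eq_or_lt with h' | h'
  · subst h'
    refine hend x ⟨hab.le, le_rfl⟩ ?_
    have : (rkU a x).eval x = 1 := by rw [rkU_eval]; field_simp; ring
    rw [this]; simpa using hc
  exact hin x h h' hx

theorem rusak_inequality_outer_part
    (a b : ℝ) (ha : 0 < a) (hab : a < b)
    (n : ℕ) (hn : 0 < n) (hne : Even n)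
    (E : Set ℝ) (hE : E = Icc (-b) (-a) ∪ Icc a b)
    (p : Polynomial ℝ) (hdeg : p.natDegree ≤ n)
    (hnorm : sSup ((fun t => |p.eval t|) '' E) = 1)
    (hgap : ∀ x ∈ Ioo (-a) a, |p.eval x| > 1)
    (S : ℝ → ℝ)
    (hS : ∀ x : ℝ, S x =
      (Polynomial.Chebyshev.T ℝ ((n / 2 : ℕ) : ℤ)).eval
        ((2 * x ^ 2 - a ^ 2 - b ^ 2) / (b ^ 2 - a ^ 2))) :
    ∀ x ∈ E, |2 * x ^ 2 - a ^ 2 - b ^ 2| ≥ (b ^ 2 - a ^ 2) * Real.cos (Real.pi / n) →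
      |(Polynomial.derivative p).eval x| ≤ |deriv S x| := by
  obtain ⟨m, hm⟩ := hne
  have hn2 : n / 2 = m := by omega
  have hm1 : 1 ≤ m := by omega
  have hD : 0 < b ^ 2 - a ^ 2 := by nlinarith
  rw [hn2] at hS
  have hSe : S = fun x => (rkS a b m).eval x := by
    funext x; rw [hS, rkS_eval a b m x _ (rkU_eval a b x)]
  have hcomp : IsCompact E := by rw [hE]; exact isCompact_Icc.union isCompact_Icc
  have hbdd : BddAbove ((fun t => |p.eval t|) '' E) :=
    (hcomp.image (by fun_prop)).bddAbove
  have hpE : ∀ y ∈ E, |p.eval y| ≤ 1 := by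
    intro y hy
    rw [← hnorm]
    exact le_csSup hbdd ⟨y, hy, rfl⟩
  have hEabs : ∀ y, y ∈ E ↔ a ≤ |y| ∧ |y| ≤ b := by
    intro y
    rw [hE]
    constructor
    · rintro (h | h)
      · rw [abs_of_neg (by linarith [h.2])]; exact ⟨by linarith [h.2], by linarith [h.1]⟩
      · rw [abs_of_pos (by linarith [h.1])]; exact h
    · rintro ⟨h1, h2⟩
      rcases abs_choice y with h | h <;> rw [h] at h1 h2
      · right; exact ⟨h1, h2⟩
      · left; exact ⟨by linarith, by linarith⟩
  have hp : ∀ y, a ≤ |y| → |y| ≤ b → |p.eval y| ≤ 1 := fun y h1 h2 => hpE y ((hEabs y).mpr ⟨h1, h2⟩)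
  have hgapc : ∀ y ∈ Icc (-a) a, 1 ≤ |p.eval y| := by
    have hcl : IsClosed {y | 1 ≤ |p.eval y|} := isClosed_le (by fun_prop) (by fun_prop)
    have : closure (Ioo (-a) a) ⊆ {y | 1 ≤ |p.eval y|} :=
      hcl.closure_subset_iff.mpr (fun z hz => (hgap z hz).le)
    rwa [closure_Ioo (by linarith)] at this
  have h1 : |p.eval a| = 1 := le_antisymm (hp a (le_abs_self a) (by rw [abs_of_pos ha]; exact hab.le))
    (hgapc a ⟨by linarith, le_rfl⟩)
  have h2 : |p.eval (-a)| = 1 := le_antisymm (hp (-a) (by rw [abs_neg]; exact le_abs_self a)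
    (by rw [abs_neg, abs_of_pos ha]; exact hab.le)) (hgapc (-a) ⟨le_rfl, by linarith⟩)
  have hpa : p.eval (-a) = p.eval a := by
    by_contra hne
    have h0 : (0:ℝ) ∈ uIcc (p.eval (-a)) (p.eval a) := by
      rw [mem_uIcc]
      rcases abs_choice (p.eval a) with h3 | h3 <;> rcases abs_choice (p.eval (-a)) with h4 | h4 <;>
        rw [h3] at h1 <;> rw [h4] at h2
      · exact absurd (h2.trans h1.symm) hne
      · left; constructor <;> linarith
      · right; constructor <;> linarith
      · exact absurd (by linarith) hne
    have hiv := intermediate_value_uIcc (a := -a) (b := a) (f := fun t => p.eval t) (by fun_prop)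
    obtain ⟨z, hz, hz0⟩ := hiv h0
    rw [uIcc_of_le (by linarith)] at hz
    have := hgapc z hz
    simp only at hz0
    rw [hz0] at this
    norm_num at this
  intro x hx hxo
  have hxU : Real.cos (Real.pi / (2 * m)) ≤ |(rkU a b).eval x| := by
    rw [rkU_eval, abs_div, abs_of_pos hD, le_div_iff₀ hD]
    have : (n:ℝ) = 2 * m := by rw [hm]; push_cast; ring
    rw [this] at hxo
    linarith
  rw [hSe, Polynomial.deriv]
  have hdeg' : p.natDegree ≤ 2 * m := by omega
  rw [hE] at hx
  rcases hx with hx | hx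
  · have hk := rk_pos a b ha hab m hm1 (p.comp (-X))
      (by rw [natDegree_comp]; simpa using hdeg')
      (fun y h1 h2 => by simpa using hp (-y) (by simpa using h1) (by simpa using h2))
      (by simp [hpa]) (-x) (by linarith [hx.2]) (by linarith [hx.1])
      (by rw [rkU_eval] at hxU ⊢; simpa using hxU)
    have hsy : (rkS a b m).comp (-X) = rkS a b m := by
      apply Polynomial.funext
      intro w
      rw [eval_comp, rkS_eval a b m w _ rfl]
      apply rkS_eval
      rw [rkU_eval, rkU_eval]; simp
    rw [← hsy] at hk
    simpa [derivative_comp] using hk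
  · exact rk_pos a b ha hab m hm1 p hdeg' hp hpa x hx.1 hx.2 hxU
end

section
/- Let 0 < a < b be real numbers, let n be a positive even integer, and let E = [−b,−a] ∪ [a,b]. Let p be a real polynomial of degree at most n with sup_{t∈E} |p(t)| ≤ 1 and |p(x)| > 1 for every x ∈ (−a,a). Then for every x in the interior of E (i.e. x ∈ (−b,−a) ∪ (a,b)), one has (b² − x²)(x² − a²)·(p′(x))² ≤ n²·x²·(1 − p(x)²). -/
open Polynomial Set

lemma bw_interval (R : ℂ[X]) (d : ℕ) (hR : R.natDegree ≤ d) (A B K : ℝ) (hB : 0 < B)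
    (hbd : ∀ s : ℝ, A - B ≤ s → s ≤ A + B → ‖R.eval (s : ℂ)‖ ≤ K)
    (v : ℂ) (hv0 : v ≠ 0) (hv : ‖v‖ ≤ 1) :
    ‖R.eval ((A : ℂ) + B * ((v + v⁻¹) / 2))‖ * ‖v‖ ^ d ≤ K := by
  let F : ℂ → ℂ := fun v => ∑ j ∈ Finset.range (d + 1),
    R.coeff j * (A * v + B * ((v ^ 2 + 1) / 2)) ^ j * v ^ (d - j)
  have hF : ∀ v : ℂ, v ≠ 0 → F v = R.eval ((A : ℂ) + B * ((v + v⁻¹) / 2)) * v ^ d := by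
    intro v hv
    rw [eval_eq_sum_range' (Nat.lt_succ_of_le hR), Finset.sum_mul]
    refine Finset.sum_congr rfl fun j hj => ?_
    have hj' : j ≤ d := Nat.lt_succ_iff.mp (Finset.mem_range.mp hj)
    have h1 : (A * v + B * ((v ^ 2 + 1) / 2) : ℂ) = (A + B * ((v + v⁻¹) / 2)) * v := by
      field_simp
    rw [h1, mul_pow]
    conv_rhs => rw [← Nat.add_sub_cancel' hj', pow_add]
    ring
  have hdiff : Differentiable ℂ F := by
    unfold F
    fun_prop
  have := Complex.norm_le_of_forall_mem_frontier_norm_le (U := Metric.ball (0:ℂ) 1) (f := F)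
    Metric.isBounded_ball hdiff.diffContOnCl (C := K) ?_ (z := v) ?_
  · rw [hF v hv0, norm_mul, norm_pow] at this
    exact this
  · intro z hz
    rw [frontier_ball _ one_ne_zero, mem_sphere_zero_iff_norm] at hz
    have hz0 : z ≠ 0 := by
      intro h; simp [h] at hz
    rw [hF z hz0, norm_mul, norm_pow, hz, one_pow, mul_one]
    have h2 : (z + z⁻¹) / 2 = (z.re : ℂ) := by
      rw [Complex.inv_def, Complex.normSq_eq_norm_sq, hz]
      apply Complex.ext <;> simp
    have h3 := Complex.abs_re_le_norm z
    rw [hz, abs_le] at h3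
    have := hbd (A + B * z.re) (by nlinarith) (by nlinarith)
    rw [h2]
    push_cast at this
    exact this
  · rw [closure_ball _ one_ne_zero]
    simpa using hv

lemma even_poly (P : ℂ[X]) (d : ℕ) (hP : P.comp (-X) = P) (hd : P.natDegree ≤ 2 * d) :
    ∃ R : ℂ[X], R.natDegree ≤ d ∧ ∀ z, P.eval z = R.eval (z ^ 2) := by
  have hodd : ∀ k, ¬ 2 ∣ k → P.coeff k = 0 := by
    intro k hk
    have h := congrArg (fun q => q.coeff k) hP
    have hX : (-X : ℂ[X]) = C (-1) * X := by simp
    simp only [hX, comp_C_mul_X_coeff] at h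
    have : Odd k := by
      rcases Nat.even_or_odd k with h | h
      · exact absurd h.two_dvd hk
      · exact h
    rw [this.neg_one_pow] at h
    have h2 : (2:ℂ) * P.coeff k = 0 := by linear_combination -h
    simpa using h2
  refine ⟨contract 2 P, ?_, ?_⟩
  · rw [natDegree_le_iff_coeff_eq_zero]
    intro N hN
    rw [coeff_contract two_ne_zero]
    exact coeff_eq_zero_of_natDegree_lt (by omega)
  · intro z
    rw [← expand_eval]
    congr 1
    ext k
    rw [coeff_expand two_pos]
    split_ifs with h
    · rw [coeff_contract two_ne_zero, Nat.div_mul_cancel h]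
    · exact hodd k h

lemma bw_two (Q : ℂ[X]) (d : ℕ) (hQ : Q.natDegree ≤ 2 * d) (a b : ℝ) (ha : 0 < a) (hab : a < b)
    (hbd : ∀ t : ℝ, a ≤ |t| → |t| ≤ b → ‖Q.eval (t : ℂ)‖ ≤ 1)
    (z v : ℂ) (hv0 : v ≠ 0) (hv : ‖v‖ ≤ 1)
    (hz : z ^ 2 = ((a^2+b^2)/2 : ℝ) + ((b^2-a^2)/2 : ℝ) * ((v + v⁻¹) / 2)) :
    ‖Q.eval z‖ * ‖v‖ ^ d ≤ 3 := by
  have hB : 0 < (b^2-a^2)/2 := by nlinarith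
  have key : ∀ (P : ℂ[X]) (e : ℕ) (K : ℝ), P.comp (-X) = P → P.natDegree ≤ 2 * e →
      (∀ t : ℝ, a ≤ |t| → |t| ≤ b → ‖P.eval (t : ℂ)‖ ≤ K) → ‖P.eval z‖ * ‖v‖ ^ e ≤ K := by
    intro P e K h1 h2 h3
    obtain ⟨R, hR, hPR⟩ := even_poly P e h1 h2
    rw [hPR, hz]
    refine bw_interval R e hR _ _ K hB ?_ v hv0 hv
    intro s hs1 hs2
    have hs1 : a^2 ≤ s := by linarith
    have hs2 : s ≤ b^2 := by linarith
    have hs0 : 0 ≤ s := by nlinarith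
    have := h3 (√s) (by rw [abs_of_nonneg (Real.sqrt_nonneg _)]; exact Real.le_sqrt_of_sq_le hs1)
      (by rw [abs_of_nonneg (Real.sqrt_nonneg _)]; exact Real.sqrt_le_iff.mpr ⟨by linarith, hs2⟩)
    rw [hPR, ← Complex.ofReal_pow, Real.sq_sqrt hs0] at this
    exact this
  have hcc : (Q.comp (-X)).comp (-X) = Q := by
    rw [comp_assoc]; simp
  have hdc : (Q.comp (-X)).natDegree ≤ 2 * d := by
    rw [natDegree_comp]; simpa using hQ
  have hbc : ∀ t : ℝ, a ≤ |t| → |t| ≤ b → ‖(Q.comp (-X)).eval (t : ℂ)‖ ≤ 1 := by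
    intro t h1 h2
    have := hbd (-t) (by rwa [abs_neg]) (by rwa [abs_neg])
    simpa using this
  have hs := key (Q + Q.comp (-X)) d 2 (by rw [add_comp, hcc, add_comm])
    (natDegree_add_le_of_degree_le hQ hdc) (by
      intro t h1 h2
      rw [eval_add]
      exact (norm_add_le _ _).trans (by linarith [hbd t h1 h2, hbc t h1 h2]))
  have hp := key (Q * Q.comp (-X)) (2 * d) 1 (by rw [mul_comp, hcc, mul_comm])
    (natDegree_mul_le.trans (by omega)) (by
      intro t h1 h2
      rw [eval_mul, norm_mul]
      exact mul_le_one₀ (hbd t h1 h2) (norm_nonneg _) (hbc t h1 h2))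
  rw [eval_add] at hs
  rw [eval_mul, norm_mul, two_mul, pow_add] at hp
  set q := ‖Q.eval z‖ * ‖v‖ ^ d with hq
  set q' := ‖(Q.comp (-X)).eval z‖ * ‖v‖ ^ d with hq'
  have hp' : q * q' ≤ 1 := by rw [hq, hq']; linarith
  have hs' : q - q' ≤ 2 := by
    have h1 : ‖Q.eval z‖ - ‖(Q.comp (-X)).eval z‖ ≤ ‖Q.eval z + (Q.comp (-X)).eval z‖ := by
      have := norm_sub_le (Q.eval z + (Q.comp (-X)).eval z) ((Q.comp (-X)).eval z)
      rw [add_sub_cancel_right] at this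
      linarith
    have h2 := mul_le_mul_of_nonneg_right h1 (pow_nonneg (norm_nonneg v) d)
    rw [hq, hq']
    linarith
  by_contra hcon
  push Not at hcon
  nlinarith

lemma bw_green (p : ℝ[X]) (m : ℕ) (hp : p.natDegree ≤ 2 * m) (a b : ℝ) (ha : 0 < a) (hab : a < b)
    (hbd : ∀ t : ℝ, a ≤ |t| → |t| ≤ b → |p.eval t| ≤ 1)
    (z v w : ℂ) (hv0 : v ≠ 0) (hv : ‖v‖ ≤ 1)
    (hz : z ^ 2 = ((a^2+b^2)/2 : ℝ) + ((b^2-a^2)/2 : ℝ) * ((v + v⁻¹) / 2))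
    (hw0 : w ≠ 0) (hw : (p.map Complex.ofRealHom).eval z = (w + w⁻¹) / 2) :
    ‖w‖ * ‖v‖ ^ m ≤ 1 := by
  have hvm : ‖v‖ ^ m ≤ 1 := pow_le_one₀ (norm_nonneg _) hv
  rcases le_total ‖w‖ 1 with h1 | h1
  · exact mul_le_one₀ h1 (by positivity) hvm
  have hk : ∀ k : ℕ, (‖w‖ * ‖v‖ ^ m) ^ k ≤ 7 := by
    intro k
    have hT := bw_two ((Chebyshev.T ℂ k).comp (p.map Complex.ofRealHom)) (m * k) (by
      rw [natDegree_comp, Chebyshev.natDegree_T, natDegree_map]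
      simp only [Int.natAbs_natCast]
      nlinarith) a b ha hab (by
      intro t h1 h2
      have := Chebyshev.abs_eval_T_real_le_one k (hbd t h1 h2)
      have h3 : (p.map Complex.ofRealHom).eval (t:ℂ) = ((p.eval t : ℝ) : ℂ) := by
        have := eval_map_apply (f := Complex.ofRealHom) (p := p) t
        simpa using this
      rw [eval_comp, h3, ← Chebyshev.complex_ofReal_eval_T, Complex.norm_real]
      exact this) z v hv0 hv hz
    rw [eval_comp, hw] at hT
    have hc : (Chebyshev.T ℂ k).eval ((w + w⁻¹) / 2) = (w ^ k + (w ^ k)⁻¹) / 2 := by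
      have e1 : Complex.cosh (Complex.log w) = (w + w⁻¹) / 2 := by
        rw [Complex.cosh, Complex.exp_neg, Complex.exp_log hw0]
      have e2 := Chebyshev.T_complex_cosh (Complex.log w) k
      rw [e1] at e2
      rw [e2, Complex.cosh, Complex.exp_neg]
      have : Complex.exp (((k:ℤ):ℂ) * Complex.log w) = w ^ k := by
        rw [Int.cast_natCast, Complex.exp_nat_mul, Complex.exp_log hw0]
      rw [this]
    rw [hc] at hT
    have hwk : 1 ≤ ‖w‖ ^ k := one_le_pow₀ h1
    have hinv : ‖(w ^ k)⁻¹‖ ≤ 1 := by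
      rw [norm_inv, norm_pow]; exact inv_le_one_of_one_le₀ hwk
    have hlow : ‖w‖ ^ k ≤ 2 * ‖(w ^ k + (w ^ k)⁻¹) / 2‖ + 1 := by
      have := norm_sub_le (w ^ k + (w ^ k)⁻¹) ((w ^ k)⁻¹)
      rw [add_sub_cancel_right, norm_pow] at this
      rw [norm_div, Complex.norm_ofNat]
      linarith
    have hvk : ‖v‖ ^ (m * k) ≤ 1 := pow_le_one₀ (norm_nonneg _) hv
    have hvk0 : 0 ≤ ‖v‖ ^ (m * k) := by positivity
    rw [mul_pow, ← pow_mul]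
    have := mul_le_mul_of_nonneg_right hlow hvk0
    linarith
  by_contra hcon
  push Not at hcon
  obtain ⟨k, hk'⟩ := pow_unbounded_of_one_lt 7 hcon
  exact absurd (hk k) (not_le.mpr hk')

lemma joukowski_branch (f : ℂ → ℂ) (x r c : ℝ) (hf : HasDerivAt f (c : ℂ) (x : ℂ))
    (hr : f x = r) (hr1 : r ^ 2 < 1) :
    ∃ w : ℂ → ℂ, (∀ z, w z ≠ 0 ∧ f z = (w z + (w z)⁻¹) / 2) ∧
      HasDerivAt (fun y : ℝ => Real.log ‖w (x + y * Complex.I)‖) (c / √(1 - r ^ 2)) 0 ∧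
      Real.log ‖w x‖ = 0 := by
  let s : ℂ → ℂ := fun z => (1 - f z ^ 2) ^ (1 / 2 : ℂ)
  have hs2 : ∀ z, s z ^ 2 = 1 - f z ^ 2 := by
    intro z
    simp only [s]
    rw [← Complex.cpow_nat_mul]
    norm_num
  let w : ℂ → ℂ := fun z => f z + Complex.I * s z
  have hmul : ∀ z, w z * (f z - Complex.I * s z) = 1 := by
    intro z
    simp only [w]
    linear_combination hs2 z - s z ^ 2 * Complex.I_sq
  have hw0 : ∀ z, w z ≠ 0 := fun z h => by simpa [h] using hmul z
  have hinv : ∀ z, (w z)⁻¹ = f z - Complex.I * s z := fun z =>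
    inv_eq_of_mul_eq_one_right (hmul z)
  have hpos : 0 < 1 - r ^ 2 := by linarith
  set σ := √(1 - r ^ 2) with hσ
  have hσ0 : 0 < σ := Real.sqrt_pos.mpr hpos
  have hσ2 : σ ^ 2 = 1 - r ^ 2 := Real.sq_sqrt hpos.le
  have hsx : s x = σ := by
    simp only [s]
    rw [hr, hσ, Real.sqrt_eq_rpow, Complex.ofReal_cpow hpos.le]
    push_cast
    rfl
  have hwx : w x = r + Complex.I * σ := by simp only [w]; rw [hsx, hr]
  have hsd : HasDerivAt s (-(r * c / σ) : ℂ) x := by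
    have h1 : HasDerivAt (fun z => 1 - f z ^ 2) (-(2 * r * c) : ℂ) x := by
      have := (hf.pow 2).const_sub 1
      refine HasDerivAt.congr_deriv this ?_
      rw [hr]; push_cast; ring
    have h2 := h1.cpow_const (c := (1/2 : ℂ)) (by
      rw [hr]; left
      have : ((1:ℂ) - r ^ 2) = ((1 - r ^ 2 : ℝ) : ℂ) := by push_cast; rfl
      rw [this, Complex.ofReal_re]; exact hpos)
    convert h2 using 1
    have hne : (1 - f x ^ 2 : ℂ) ≠ 0 := by
      rw [← hs2, hsx]; exact_mod_cast (pow_pos hσ0 2).ne'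
    rw [Complex.cpow_sub _ _ hne, Complex.cpow_one]
    have h3 : (1 - f x ^ 2 : ℂ) ^ (1/2 : ℂ) = σ := hsx
    have h4 : (1 - f x ^ 2 : ℂ) = σ ^ 2 := by rw [← hs2, hsx]
    rw [h3, h4]
    have : (σ : ℂ) ≠ 0 := by exact_mod_cast hσ0.ne'
    field_simp
  have hwd : HasDerivAt w (-(Complex.I * (c / σ)) * w x) x := by
    have := hf.add (hsd.const_mul Complex.I)
    refine HasDerivAt.congr_deriv this ?_
    have : (σ : ℂ) ≠ 0 := by exact_mod_cast hσ0.ne'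
    rw [hwx]
    field_simp
    linear_combination (c:ℂ) * σ * Complex.I_sq
  have hld : HasDerivAt (fun z => Complex.log (w z)) (-(Complex.I * (c / σ))) x := by
    have := hwd.clog (by
      right; rw [hwx]; simp; exact hσ0.ne')
    rwa [mul_div_assoc, div_self (hw0 x), mul_one] at this
  refine ⟨w, fun z => ⟨hw0 z, by rw [hinv]; simp only [w]; ring⟩, ?_, ?_⟩
  · have hin : HasDerivAt (fun y : ℂ => (x : ℂ) + y * Complex.I) Complex.I ((0:ℝ):ℂ) := by
      simpa using ((hasDerivAt_id ((0:ℝ):ℂ)).mul_const Complex.I).const_add (x:ℂ)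
    have h1 : HasDerivAt (fun y : ℂ => Complex.log (w (x + y * Complex.I))) (c / σ : ℂ)
        ((0:ℝ):ℂ) := by
      have := HasDerivAt.comp ((0:ℝ):ℂ) (h₂ := fun z => Complex.log (w z)) (by
        simpa using hld) hin
      refine HasDerivAt.congr_deriv this ?_
      linear_combination -(c / σ : ℂ) * Complex.I_sq
    have h2 := h1.real_of_complex
    simp only [Complex.log_re] at h2
    convert h2 using 1
    rw [← Complex.ofReal_div, Complex.ofReal_re]
  · have : ‖w x‖ ^ 2 = 1 := by
      rw [hwx, ← Complex.normSq_eq_norm_sq, Complex.normSq_apply]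
      simp
      nlinarith
    have : ‖w x‖ = 1 := by
      nlinarith [norm_nonneg (w x)]
    rw [this, Real.log_one]

lemma deriv_compare (f g : ℝ → ℝ) (A B M : ℝ) (hf : HasDerivAt f A 0) (hg : HasDerivAt g B 0)
    (hf0 : f 0 = 0) (hg0 : g 0 = 0) (h : ∀ y, |f y| ≤ M * |g y|) : |A| ≤ M * |B| := by
  have h1 := hf.tendsto_slope.abs
  have h2 := hg.tendsto_slope.abs.const_mul M
  refine le_of_tendsto_of_tendsto' h1 h2 fun y => ?_
  simp only [slope, hf0, hg0, sub_zero, vsub_eq_sub, smul_eq_mul, abs_mul]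
  have := mul_le_mul_of_nonneg_left (h y) (abs_nonneg y⁻¹)
  linarith

theorem bernstein_type_inequality_two_intervals
    (a b : ℝ) (ha : 0 < a) (hab : a < b)
    (n : ℕ) (hn : 0 < n) (hne : Even n)
    (E : Set ℝ) (hE : E = Icc (-b) (-a) ∪ Icc a b)
    (p : Polynomial ℝ) (hdeg : p.natDegree ≤ n)
    (hnorm : ∀ t ∈ E, |p.eval t| ≤ 1)
    (hgap : ∀ x ∈ Ioo (-a) a, |p.eval x| > 1) :
    ∀ x ∈ Ioo (-b) (-a) ∪ Ioo a b,
      (b ^ 2 - x ^ 2) * (x ^ 2 - a ^ 2) * ((Polynomial.derivative p).eval x) ^ 2 ≤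
        (n : ℝ) ^ 2 * x ^ 2 * (1 - (p.eval x) ^ 2) := by
  intro x hx
  obtain ⟨m, hm⟩ := hne
  have hbd : ∀ t : ℝ, a ≤ |t| → |t| ≤ b → |p.eval t| ≤ 1 := by
    intro t h1 h2
    apply hnorm
    rw [hE]
    rcases abs_cases t with ⟨h, _⟩ | ⟨h, _⟩
    · right; constructor <;> linarith
    · left; constructor <;> linarith
  have hxI : ∀ t ∈ Ioo (-b) (-a) ∪ Ioo a b, a < |t| ∧ |t| < b := by
    intro t ht
    rcases ht with ⟨h1, h2⟩ | ⟨h1, h2⟩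
    · rw [abs_of_neg (by linarith)]; constructor <;> linarith
    · rw [abs_of_pos (by linarith)]; constructor <;> linarith
  obtain ⟨hx1, hx2⟩ := hxI x hx
  have hxa : a ^ 2 < x ^ 2 := by rw [← sq_abs x]; nlinarith
  have hxb : x ^ 2 < b ^ 2 := by rw [← sq_abs x]; nlinarith [abs_nonneg x]
  have hpx := hbd x hx1.le hx2.le
  have hpx2 : p.eval x ^ 2 ≤ 1 := (sq_le_one_iff_abs_le_one _).mpr hpx
  rcases hpx2.eq_or_lt with hone | hlt
  · -- interior extremum
    have hopen : Ioo (-b) (-a) ∪ Ioo a b ∈ nhds x := (isOpen_Ioo.union isOpen_Ioo).mem_nhds hx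
    have hmax : IsLocalMax (fun t => p.eval t ^ 2) x := by
      filter_upwards [hopen] with t ht
      rw [hone]
      exact (sq_le_one_iff_abs_le_one _).mpr (hbd t (hxI t ht).1.le (hxI t ht).2.le)
    have hd : HasDerivAt (fun t => p.eval t ^ 2) (2 * p.eval x * (derivative p).eval x) x := by
      have := (p.hasDerivAt x).pow 2
      refine HasDerivAt.congr_deriv this ?_
      push_cast; ring
    have h0 := hmax.hasDerivAt_eq_zero hd
    have hp0 : p.eval x ≠ 0 := by
      intro h; rw [h] at hone; norm_num at hone
    have : (derivative p).eval x = 0 := by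
      rcases mul_eq_zero.mp h0 with h | h
      · exact absurd h (by simpa using hp0)
      · exact h
    rw [this, hone]; simp
  have hB : 0 < b ^ 2 - a ^ 2 := by linarith
  -- the two branches
  have hev : ∀ (q : ℝ[X]) (t : ℝ), (q.map Complex.ofRealHom).eval (t:ℂ) = ((q.eval t : ℝ) : ℂ) := by
    intro q t
    have := eval_map_apply (f := Complex.ofRealHom) (p := q) t
    simpa using this
  obtain ⟨w, hw, hwd, hwx⟩ := joukowski_branch (fun z => (p.map Complex.ofRealHom).eval z) x
    (p.eval x) ((derivative p).eval x) (by
      have := (p.map Complex.ofRealHom).hasDerivAt (x:ℂ)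
      rwa [derivative_map, hev] at this) (hev p x) hlt
  set r := (2 * x ^ 2 - (a ^ 2 + b ^ 2)) / (b ^ 2 - a ^ 2) with hrdef
  have hr : 1 - r ^ 2 = 4 * (b ^ 2 - x ^ 2) * (x ^ 2 - a ^ 2) / (b ^ 2 - a ^ 2) ^ 2 := by
    rw [hrdef]; field_simp; ring
  have hG : 0 < (b ^ 2 - x ^ 2) * (x ^ 2 - a ^ 2) :=
    mul_pos (by linarith) (by linarith)
  have hrpos : 0 < 1 - r ^ 2 := by
    rw [hr, mul_assoc]; positivity
  obtain ⟨v, hv, hvd, hvx⟩ := joukowski_branch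
    (fun z => (2 * z ^ 2 - (a ^ 2 + b ^ 2)) / (b ^ 2 - a ^ 2)) x r (4 * x / (b ^ 2 - a ^ 2)) (by
      have := ((((hasDerivAt_id (x:ℂ)).pow 2).const_mul 2).sub_const ((a:ℂ) ^ 2 + b ^ 2)).div_const
        ((b:ℂ) ^ 2 - a ^ 2)
      refine HasDerivAt.congr_deriv this ?_
      push_cast; simp; ring) (by rw [hrdef]; push_cast; rfl) (by linarith)
  have hcmp := deriv_compare _ _ _ _ (m : ℝ) hwd hvd (by simpa using hwx) (by simpa using hvx) (by
    intro y
    set z : ℂ := x + y * Complex.I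
    obtain ⟨hw0, hw1⟩ := hw z
    obtain ⟨hv0, hv1⟩ := hv z
    have hz : z ^ 2 = ((a^2+b^2)/2 : ℝ) + ((b^2-a^2)/2 : ℝ) * ((v z + (v z)⁻¹) / 2) := by
      rw [← hv1]
      have : ((b:ℂ) ^ 2 - a ^ 2) ≠ 0 := by exact_mod_cast hB.ne'
      push_cast
      field_simp
      ring
    have main : ∀ V W : ℂ, V ≠ 0 → ‖V‖ ≤ 1 → W ≠ 0 → (v z + (v z)⁻¹) / 2 = (V + V⁻¹) / 2 →
        (w z + (w z)⁻¹) / 2 = (W + W⁻¹) / 2 → Real.log ‖W‖ + m * Real.log ‖V‖ ≤ 0 := by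
      intro V W hV0 hV hW0 e1 e2
      have := bw_green p m (by omega) a b ha hab hbd z V W hV0 hV (by rw [← e1]; exact hz) hW0
        (by rw [← e2]; exact hw1)
      rw [← Real.log_pow, ← Real.log_mul (by simpa using hW0) (by simp [hV0])]
      exact Real.log_nonpos (by positivity) this
    have hwn : 0 < ‖w z‖ := norm_pos_iff.mpr hw0
    have hvn : 0 < ‖v z‖ := norm_pos_iff.mpr hv0
    have ew : (w z + (w z)⁻¹) / 2 = ((w z)⁻¹ + (w z)⁻¹⁻¹) / 2 := by rw [inv_inv, add_comm]
    have ev : (v z + (v z)⁻¹) / 2 = ((v z)⁻¹ + (v z)⁻¹⁻¹) / 2 := by rw [inv_inv, add_comm]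
    rcases le_total ‖v z‖ 1 with h1 | h1
    · have i1 := main (v z) (w z) hv0 h1 hw0 rfl rfl
      have i2 := main (v z) (w z)⁻¹ hv0 h1 (inv_ne_zero hw0) rfl ew
      rw [norm_inv, Real.log_inv] at i2
      rw [abs_of_nonpos (Real.log_nonpos hvn.le h1), abs_le]
      constructor <;> linarith
    · have h1' : ‖(v z)⁻¹‖ ≤ 1 := by rw [norm_inv]; exact inv_le_one_of_one_le₀ h1
      have i1 := main (v z)⁻¹ (w z) (inv_ne_zero hv0) h1' hw0 ev rfl
      have i2 := main (v z)⁻¹ (w z)⁻¹ (inv_ne_zero hv0) h1' (inv_ne_zero hw0) ev ew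
      rw [norm_inv (v z), Real.log_inv] at i1 i2
      rw [norm_inv, Real.log_inv] at i2
      rw [abs_of_nonneg (Real.log_nonneg h1), abs_le]
      constructor <;> linarith)
  have hsq := pow_le_pow_left₀ (abs_nonneg _) hcmp 2
  rw [mul_pow, sq_abs, sq_abs, div_pow, div_pow, Real.sq_sqrt (by linarith),
    Real.sq_sqrt hrpos.le, hr] at hsq
  have hD : 0 < 1 - p.eval x ^ 2 := by linarith
  have e : (m:ℝ) ^ 2 * ((4 * x / (b ^ 2 - a ^ 2)) ^ 2 /
      (4 * (b ^ 2 - x ^ 2) * (x ^ 2 - a ^ 2) / (b ^ 2 - a ^ 2) ^ 2)) =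
      (n:ℝ) ^ 2 * x ^ 2 / ((b ^ 2 - x ^ 2) * (x ^ 2 - a ^ 2)) := by
    have h1 : b ^ 2 - x ^ 2 ≠ 0 := by linarith
    have h2 : x ^ 2 - a ^ 2 ≠ 0 := by linarith
    rw [hm]; push_cast
    field_simp
    ring
  rw [e, div_le_div_iff₀ hD hG] at hsq
  linarith
end
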